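/- Let f ∈ H²(𝔹). The following are equivalent: (i) f is inner; (ii) ‖f‖_{H²} = ‖f‖_{H^∞} = 1; (iii) ‖f‖_{H²} = 1 and for all k ∈ ℕ and all λ ∈ ℍ one has ‖(qᵏ + λ) * f‖_{H²} ≤ ‖qᵏ + λ‖_{H²}. -/

import Mathlib

open MeasureTheory Filter Topology
open scoped ENNReal Classical

noncomputable section

/-! ### Basic quaternionic notions -/

instance : MeasurableSpace (Quaternion ℝ) := borel _
instance : BorelSpace (Quaternion ℝ) := ⟨rfl⟩

/-- The 2-sphere `𝕊` of quaternionic imaginary units. -/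
def USphere : Set (Quaternion ℝ) := {q | q ^ 2 = -1}

/-- The open quaternionic unit ball `𝔹`. -/
def QBall : Set (Quaternion ℝ) := {q | ‖q‖ < 1}

/-- The slice `L_I = ℝ + ℝI` through an imaginary unit `I`. -/
def sliceSet (I : Quaternion ℝ) : Set (Quaternion ℝ) :=
  {q | ∃ x y : ℝ, q = (x : Quaternion ℝ) + y • I}

/-- The point `e^{tI} = cos t + (sin t) I` of the boundary circle `∂𝔹_I`. -/
def ptOn (I : Quaternion ℝ) (t : ℝ) : Quaternion ℝ :=
  ((Real.cos t : ℝ) : Quaternion ℝ) + Real.sin t • I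

/-- Slice regularity on the unit ball: on every slice the restriction of `f` has partial
derivatives satisfying the Cauchy–Riemann equation `∂f/∂x + I ∂f/∂y = 0`. -/
def SliceRegular (f : Quaternion ℝ → Quaternion ℝ) : Prop :=
  ∀ I ∈ USphere, ∀ x y : ℝ, ((x : Quaternion ℝ) + y • I) ∈ QBall →
    ∃ fx fy : Quaternion ℝ,
      HasDerivAt (fun s : ℝ => f ((s : Quaternion ℝ) + y • I)) fx x ∧
      HasDerivAt (fun t : ℝ => f ((x : Quaternion ℝ) + t • I)) fy y ∧
      fx + I * fy = 0

/-! ### The Hardy space `H²(𝔹)` via power series coefficients.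
A slice regular function on `𝔹` is identified with its coefficient sequence
`a : ℕ → ℍ`, the function being `q ↦ ∑ qⁿ aₙ`. -/

/-- Membership in `H²(𝔹)`: square-summable coefficients. -/
def MemH2 (a : ℕ → Quaternion ℝ) : Prop := Summable (fun n => ‖a n‖ ^ 2)

/-- Evaluation of the power series `q ↦ ∑ qⁿ aₙ`. -/
def evalS (a : ℕ → Quaternion ℝ) (q : Quaternion ℝ) : Quaternion ℝ := ∑' n, q ^ n * a n

/-- The `*`-product (slice product) on coefficient sequences. -/
def sProd (a b : ℕ → Quaternion ℝ) : ℕ → Quaternion ℝ :=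
  fun n => ∑ k ∈ Finset.range (n + 1), a k * b (n - k)

/-- The regular conjugate `fᶜ`. -/
def conjS (a : ℕ → Quaternion ℝ) : ℕ → Quaternion ℝ := fun n => star (a n)

/-- The symmetrization `fˢ = f * fᶜ`. -/
def symmS (a : ℕ → Quaternion ℝ) : ℕ → Quaternion ℝ := sProd a (conjS a)

/-- The squared `H²` norm `∑ ‖aₙ‖²`. -/
def h2normSq (a : ℕ → Quaternion ℝ) : ℝ := ∑' n, ‖a n‖ ^ 2

/-- The `H²` norm. -/
def h2norm (a : ℕ → Quaternion ℝ) : ℝ := Real.sqrt (h2normSq a)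

/-- The (right) quaternionic inner product `⟨f,g⟩ = ∑ conj(bₙ) aₙ` of `H²(𝔹)`. -/
def h2inner (a b : ℕ → Quaternion ℝ) : Quaternion ℝ := ∑' n, star (b n) * a n

/-- Squared `H²`-distance of two coefficient sequences (valued in `ℝ≥0∞`). -/
def h2distSq (a b : ℕ → Quaternion ℝ) : ℝ≥0∞ := ∑' n, (‖a n - b n‖₊ : ℝ≥0∞) ^ 2

/-- The boundary value function of `f ∈ H²(𝔹)`, given by the radial limit where it exists. -/
def bdval (a : ℕ → Quaternion ℝ) (q : Quaternion ℝ) : Quaternion ℝ :=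
  if h : ∃ L, Tendsto (fun r : ℝ => evalS a ((r : Quaternion ℝ) * q)) (𝓝[<] (1 : ℝ)) (𝓝 L)
  then h.choose else 0

/-! ### The measure `Σ` on `∂𝔹` with `dΣ(e^{tI}) = dσ(I) dt`. -/

/-- The normalized area measure `σ` on the sphere `𝕊` of imaginary units
(2-dimensional Hausdorff measure, normalized so that `σ(𝕊) = 1`). -/
def sphMeasure : Measure (Quaternion ℝ) := (μH[2] USphere)⁻¹ • (μH[2]).restrict USphere

/-- The measure `Σ` on `∂𝔹`, `dΣ(e^{tI}) = dσ(I) dt`, normalized so `Σ(∂𝔹) = 1`. -/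
def SigmaBd : Measure (Quaternion ℝ) :=
  (ENNReal.ofReal (2 * Real.pi))⁻¹ •
    Measure.map (fun p : ℝ × Quaternion ℝ => ptOn p.2 p.1)
      ((volume.restrict (Set.Ico 0 (2 * Real.pi))).prod sphMeasure)

/-! ### Inner, outer, cyclic -/

/-- `f ∈ H^∞(𝔹)`: a bounded function of `H²(𝔹)`. -/
def MemHinf (a : ℕ → Quaternion ℝ) : Prop :=
  MemH2 a ∧ ∃ C : ℝ, ∀ q ∈ QBall, ‖evalS a q‖ ≤ C

/-- The `H^∞` norm: the sup of `‖f‖` on the ball. -/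
def hInfNorm (a : ℕ → Quaternion ℝ) : ℝ := sSup ((fun q => ‖evalS a q‖) '' QBall)

/-- `f` is inner: `f ∈ H^∞(𝔹)`, `‖f‖ ≤ 1` on `𝔹` and `‖f‖ = 1` `Σ`-a.e. on `∂𝔹`. -/
def IsInnerQ (a : ℕ → Quaternion ℝ) : Prop :=
  MemH2 a ∧ (∀ q ∈ QBall, ‖evalS a q‖ ≤ 1) ∧ (∀ᵐ q ∂SigmaBd, ‖bdval a q‖ = 1)

/-- `g` is outer: whenever `f ∈ H²(𝔹)` has the same boundary modulus `Σ`-a.e.,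
then `‖g‖ ≥ ‖f‖` throughout `𝔹`. -/
def IsOuterQ (g : ℕ → Quaternion ℝ) : Prop :=
  MemH2 g ∧ ∀ f, MemH2 f → (∀ᵐ q ∂SigmaBd, ‖bdval g q‖ = ‖bdval f q‖) →
    ∀ q ∈ QBall, ‖evalS f q‖ ≤ ‖evalS g q‖

/-- Quaternionic polynomials (finitely supported coefficient sequences). -/
def IsPolyQ (p : ℕ → Quaternion ℝ) : Prop := ∃ N, ∀ n > N, p n = 0

/-- Quaternionic polynomials of degree at most `n` (the space `𝒫_n`). -/
def IsPolyDeg (p : ℕ → Quaternion ℝ) (n : ℕ) : Prop := ∀ m > n, p m = 0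

/-- The coefficient sequence of the monomial `qᵏ`. -/
def qpow (k : ℕ) : ℕ → Quaternion ℝ := fun n => if n = k then 1 else 0

/-- The coefficient sequence of a constant function. -/
def constS (c : Quaternion ℝ) : ℕ → Quaternion ℝ := fun n => if n = 0 then c else 0

/-- The coefficient sequence of the constant function `1`. -/
def oneS : ℕ → Quaternion ℝ := constS 1

/-- The invariant subspace `[g]`: the `H²`-closure of `{g * p : p polynomial}`,
i.e. of the right span of `{qⁿ * g : n ≥ 0}`. -/
def InvSub (g : ℕ → Quaternion ℝ) : Set (ℕ → Quaternion ℝ) :=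
  {h | MemH2 h ∧ ∀ ε : ℝ≥0∞, 0 < ε → ∃ p, IsPolyQ p ∧ h2distSq (sProd g p) h < ε}

/-- `g` is cyclic: `[g] = H²(𝔹)`. -/
def IsCyclicQ (g : ℕ → Quaternion ℝ) : Prop :=
  MemH2 g ∧ ∀ h, MemH2 h → h ∈ InvSub g

/-! ### Bilateral (slice `L²`) series, used for boundary products -/

/-- Bilateral coefficients of `f̃(q) = f(q̄)` on `∂𝔹`: `Σ_{n ≤ 0} qⁿ a_{-n}`. -/
def tildeZ (a : ℕ → Quaternion ℝ) : ℤ → Quaternion ℝ :=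
  fun k => if k ≤ 0 then a (-k).toNat else 0

/-- Bilateral coefficients of `fᶜ` on `∂𝔹`. -/
def conjZ (a : ℕ → Quaternion ℝ) : ℤ → Quaternion ℝ :=
  fun k => if 0 ≤ k then star (a k.toNat) else 0

/-- The `*`-product of two slice `L²` functions on the boundary, on coefficients. -/
def convZ (c b : ℤ → Quaternion ℝ) : ℤ → Quaternion ℝ := fun n => ∑' k : ℤ, c k * b (n - k)

/-- Evaluation of a bilateral series `q ↦ ∑_{n ∈ ℤ} qⁿ dₙ`. -/
def evalZ (d : ℤ → Quaternion ℝ) (q : Quaternion ℝ) : Quaternion ℝ := ∑' n : ℤ, q ^ n * d n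

/-- The slice inner product `⟨qᵏ * f, f⟩_I = (1/2π)∫₀^{2π} conj(f(e^{θI})) (e^{θI})ᵏ f(e^{θI}) dθ`,
computed with boundary values; note `(qᵏ * f)(q) = qᵏ f(q)` pointwise. -/
def sliceInnerPow (a : ℕ → Quaternion ℝ) (I : Quaternion ℝ) (k : ℕ) : Quaternion ℝ :=
  (2 * Real.pi)⁻¹ •
    ∫ t in Set.Ico 0 (2 * Real.pi), star (bdval a (ptOn I t)) * ((ptOn I t) ^ k * bdval a (ptOn I t))

/-! ### Complex Hardy space `H²(𝔻)` notions (for slice restrictions) -/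

/-- Membership in the complex Hardy space `H²(𝔻)` via coefficients. -/
def CMemH2 (c : ℕ → ℂ) : Prop := Summable (fun n => ‖c n‖ ^ 2)

/-- Evaluation of a complex power series. -/
def cEval (c : ℕ → ℂ) (z : ℂ) : ℂ := ∑' n, z ^ n * c n

/-- Cauchy product of complex coefficient sequences. -/
def cConv (c d : ℕ → ℂ) : ℕ → ℂ := fun n => ∑ k ∈ Finset.range (n + 1), c k * d (n - k)

/-- Squared `H²(𝔻)` distance. -/
def cDistSq (c d : ℕ → ℂ) : ℝ≥0∞ := ∑' n, (‖c n - d n‖₊ : ℝ≥0∞) ^ 2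

/-- Radial boundary values of a complex `H²` function. -/
def cBdval (c : ℕ → ℂ) (z : ℂ) : ℂ :=
  if h : ∃ L, Tendsto (fun r : ℝ => cEval c ((r : ℂ) * z)) (𝓝[<] (1 : ℝ)) (𝓝 L)
  then h.choose else 0

/-- Lebesgue measure on the unit circle `∂𝔻` (parametrized by `θ ∈ [0, 2π)`). -/
def circleM : Measure ℂ :=
  Measure.map (fun t : ℝ => Complex.exp (t * Complex.I)) (volume.restrict (Set.Ico 0 (2 * Real.pi)))

/-- Cyclicity in `H²(𝔻)`: polynomial multiples of `c` are dense. -/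
def CIsCyclic (c : ℕ → ℂ) : Prop :=
  CMemH2 c ∧ ∀ h, CMemH2 h → ∀ ε : ℝ≥0∞, 0 < ε →
    ∃ p : ℕ → ℂ, (∃ N, ∀ n > N, p n = 0) ∧ cDistSq (cConv c p) h < ε

/-- Outerness in `H²(𝔻)` (in the sense matching Definition 2.10 of the paper). -/
def CIsOuter (c : ℕ → ℂ) : Prop :=
  CMemH2 c ∧ ∀ h, CMemH2 h →
    (∀ᵐ z ∂circleM, ‖cBdval c z‖ = ‖cBdval h z‖) →
    ∀ z ∈ Metric.ball (0 : ℂ) 1, ‖cEval h z‖ ≤ ‖cEval c z‖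

/-- Complex coordinates of a point of the slice `L_I`: if `p = x + yI` then
`sliceToC I p = x + iy`. -/
def sliceToC (I : Quaternion ℝ) (p : Quaternion ℝ) : ℂ := ⟨p.re, -(p * I).re⟩

/-- The quaternion `i`. -/
def qI : Quaternion ℝ := ⟨0, 1, 0, 0⟩

/-- The embedding of `ℂ = L_i` into the quaternions. -/
def cToQ (z : ℂ) : Quaternion ℝ := (z.re : Quaternion ℝ) + z.im • qI

/-- The imaginary unit `I_ω` identified by `ω` (any imaginary unit if `ω` is real). -/
def Iu (ω : Quaternion ℝ) : Quaternion ℝ := if ω.im = 0 then qI else ‖ω.im‖⁻¹ • ω.im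

/-! ### Optimal approximants -/

/-- `p` is an optimal approximant of degree `n` of `f^{-*}`: `p ∈ 𝒫_n` minimizes
`‖f * p - 1‖_{H²}` among all `p ∈ 𝒫_n`. -/
def IsOptApprox (a : ℕ → Quaternion ℝ) (n : ℕ) (p : ℕ → Quaternion ℝ) : Prop :=
  IsPolyDeg p n ∧ ∀ r, IsPolyDeg r n → h2distSq (sProd a p) oneS ≤ h2distSq (sProd a r) oneS

end
local notation "ℚt" => Quaternion ℝ

lemma usphere_iff (I : ℚt) : I ∈ USphere ↔ I.re = 0 ∧ I.imI ^ 2 + I.imJ ^ 2 + I.imK ^ 2 = 1 := by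
  have h2 : I ∈ USphere ↔ I ^ 2 = -1 := Iff.rfl
  rw [h2, pow_two, Quaternion.ext_iff]
  simp only [Quaternion.re_mul, Quaternion.imI_mul, Quaternion.imJ_mul, Quaternion.imK_mul,
    Quaternion.re_neg, Quaternion.imI_neg, Quaternion.imJ_neg, Quaternion.imK_neg,
    Quaternion.re_one, Quaternion.imI_one, Quaternion.imJ_one, Quaternion.imK_one]
  constructor
  · rintro ⟨h0, h1, h2, h3⟩
    by_cases hr : I.re = 0
    · refine ⟨hr, ?_⟩
      rw [hr] at h0
      linarith
    · exfalso
      have e1 : I.imI = 0 := by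
        have : I.re * I.imI = 0 := by linarith
        simpa [hr] using this
      have e2 : I.imJ = 0 := by
        have : I.re * I.imJ = 0 := by linarith
        simpa [hr] using this
      have e3 : I.imK = 0 := by
        have : I.re * I.imK = 0 := by linarith
        simpa [hr] using this
      rw [e1, e2, e3] at h0
      nlinarith [mul_self_nonneg I.re]
  · rintro ⟨hr, h⟩
    rw [hr]
    refine ⟨by linarith, by ring, by ring, by ring⟩

lemma norm_sq_eq (q : ℚt) : ‖q‖ ^ 2 = q.re ^ 2 + q.imI ^ 2 + q.imJ ^ 2 + q.imK ^ 2 := by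
  rw [pow_two, ← Quaternion.normSq_eq_norm_mul_self, Quaternion.normSq_def']

lemma usphere_mul_self {I : ℚt} (hI : I ∈ USphere) : I * I = -1 := by
  have : I ^ 2 = -1 := hI
  rwa [pow_two] at this

lemma usphere_norm {I : ℚt} (hI : I ∈ USphere) : ‖I‖ = 1 := by
  have h := (usphere_iff I).1 hI
  have : ‖I‖ ^ 2 = 1 := by rw [norm_sq_eq, h.1]; linarith [h.2]
  have h0 := norm_nonneg I
  nlinarith

lemma usphere_star {I : ℚt} (hI : I ∈ USphere) : star I = -I := by
  have h := (usphere_iff I).1 hI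
  ext <;> simp [h.1]

lemma usphere_closed : IsClosed USphere := by
  have : USphere = {q : ℚt | q ^ 2 = -1} := rfl
  rw [this]
  exact isClosed_eq (by fun_prop) (by fun_prop)

lemma coe_eq_smul (r : ℝ) : (r : ℚt) = r • (1 : ℚt) := by
  rw [← Quaternion.algebraMap_def, Algebra.algebraMap_eq_smul_one]

lemma ptOn_add {I : ℚt} (hI : I ∈ USphere) (s t : ℝ) : ptOn I (s + t) = ptOn I s * ptOn I t := by
  simp only [ptOn, Real.cos_add, Real.sin_add, coe_eq_smul, mul_add, add_mul, smul_mul_assoc,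
    mul_smul_comm, one_mul, mul_one, usphere_mul_self hI]
  module

lemma ptOn_zero (I : ℚt) : ptOn I 0 = 1 := by
  simp [ptOn]

lemma ptOn_pow {I : ℚt} (hI : I ∈ USphere) (t : ℝ) (n : ℕ) : ptOn I t ^ n = ptOn I (n * t) := by
  induction n with
  | zero => simp [ptOn_zero]
  | succ n ih =>
    rw [pow_succ, ih, ← ptOn_add hI]
    congr 1; push_cast; ring

lemma ptOn_norm {I : ℚt} (hI : I ∈ USphere) (t : ℝ) : ‖ptOn I t‖ = 1 := by
  have h := (usphere_iff I).1 hI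
  have : ‖ptOn I t‖ ^ 2 = 1 := by
    rw [norm_sq_eq]
    simp only [ptOn]
    simp [h.1]
    have := Real.sin_sq_add_cos_sq t
    have h2 := h.2
    calc _ = Real.cos t ^ 2 + Real.sin t ^ 2 * (I.imI ^ 2 + I.imJ ^ 2 + I.imK ^ 2) := by ring
      _ = 1 := by rw [h2]; linarith
  have h0 := norm_nonneg (ptOn I t)
  nlinarith

lemma ptOn_continuous : Continuous (fun p : ℝ × ℚt => ptOn p.2 p.1) := by
  unfold ptOn
  exact (Quaternion.continuous_coe.comp (Real.continuous_cos.comp continuous_fst)).add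
    ((Real.continuous_sin.comp continuous_fst).smul continuous_snd)

lemma ptOn_cont (I : ℚt) : Continuous (fun t : ℝ => ptOn I t) := by
  unfold ptOn
  exact (Quaternion.continuous_coe.comp Real.continuous_cos).add
    (Real.continuous_sin.smul continuous_const)

lemma ptOn_hasDeriv {I : ℚt} (hI : I ∈ USphere) (t : ℝ) :
    HasDerivAt (fun t => ptOn I t) (I * ptOn I t) t := by
  have h : HasDerivAt (fun t => Real.cos t • (1 : ℚt) + Real.sin t • I)
      ((-Real.sin t) • (1 : ℚt) + Real.cos t • I) t :=
    ((Real.hasDerivAt_cos t).smul_const _).add ((Real.hasDerivAt_sin t).smul_const _)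
  simp only [ptOn, coe_eq_smul]
  convert h using 1
  simp only [mul_add, mul_smul_comm, usphere_mul_self hI, mul_one]
  module

/-- each quaternion is on a slice -/
lemma exists_slice (q : ℚt) : ∃ I ∈ USphere, ∃ t : ℝ, q = (‖q‖ : ℚt) * ptOn I t := by
  by_cases h : q.im = 0
  · refine ⟨qI, ?_, ?_⟩
    · rw [usphere_iff]; simp [qI]
    · have hq : q = (q.re : ℚt) := by
        rw [← Quaternion.re_add_im q, h]; simp
      rcases le_total 0 q.re with h0 | h0
      · refine ⟨0, ?_⟩
        rw [ptOn_zero, mul_one]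
        have : ‖q‖ = q.re := by rw [hq]; simpa using h0
        rw [this, ← hq]
      · refine ⟨Real.pi, ?_⟩
        have : ‖q‖ = -q.re := by
          rw [hq]; simp [h0]
        rw [this]
        simp only [ptOn, Real.cos_pi, Real.sin_pi]
        rw [hq]; ext <;> simp
  · have hn : 0 < ‖q.im‖ := norm_pos_iff.2 h
    have hns : ‖q.im‖ ^ 2 = q.imI ^ 2 + q.imJ ^ 2 + q.imK ^ 2 := by rw [norm_sq_eq]; simp
    have hnq : ‖q‖ ^ 2 = q.re ^ 2 + ‖q.im‖ ^ 2 := by rw [norm_sq_eq, hns]; ring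
    refine ⟨‖q.im‖⁻¹ • q.im, ?_, ?_⟩
    · rw [usphere_iff]
      simp only [Quaternion.re_smul, Quaternion.imI_smul, Quaternion.imJ_smul, Quaternion.imK_smul,
        Quaternion.re_im, Quaternion.imI_im, Quaternion.imJ_im, Quaternion.imK_im, smul_eq_mul,
        mul_zero, true_and]
      field_simp
      exact hns.symm
    · let z : ℂ := ⟨q.re, ‖q.im‖⟩
      have hz : ‖z‖ = ‖q‖ := by
        have : ‖z‖ ^ 2 = ‖q‖ ^ 2 := by
          rw [← Complex.normSq_eq_norm_sq, Complex.normSq_apply, hnq]; simp [z]; ring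
        exact (pow_left_inj₀ (norm_nonneg _) (norm_nonneg _) (by norm_num)).1 this
      refine ⟨Complex.arg z, ?_⟩
      have h1 := Complex.norm_mul_cos_arg z
      have h2 := Complex.norm_mul_sin_arg z
      rw [hz] at h1 h2
      simp only [z] at h1 h2
      simp only [ptOn, coe_eq_smul, smul_mul_assoc, one_mul, smul_add, smul_smul]
      rw [h1, ← mul_assoc, h2, mul_inv_cancel₀ hn.ne', one_smul, ← coe_eq_smul]
      exact (Quaternion.re_add_im q).symm

lemma coe_comm (r : ℝ) (q : ℚt) : (r : ℚt) * q = q * (r : ℚt) := by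
  simp [coe_eq_smul]

lemma slice_pow {I : ℚt} (hI : I ∈ USphere) (r t : ℝ) (n : ℕ) :
    ((r : ℚt) * ptOn I t) ^ n = (r ^ n) • ptOn I (n * t) := by
  rw [(show Commute (r : ℚt) (ptOn I t) from coe_comm r _).mul_pow, ptOn_pow hI]
  rw [← Quaternion.coe_pow, coe_eq_smul, smul_mul_assoc, one_mul]

lemma coef_le {a : ℕ → ℚt} (ha : MemH2 a) : ∃ M, ∀ n, ‖a n‖ ≤ M := by
  refine ⟨∑' n, ‖a n‖ ^ 2 + 1, fun n => ?_⟩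
  have : ‖a n‖ ^ 2 ≤ ∑' n, ‖a n‖ ^ 2 := ha.le_tsum n (fun _ _ => by positivity)
  nlinarith [sq_nonneg (‖a n‖ - 1), norm_nonneg (a n)]

lemma summ_pow {a : ℕ → ℚt} (ha : MemH2 a) {r : ℝ} (h0 : 0 ≤ r) (h1 : r < 1) :
    Summable (fun n => r ^ n * ‖a n‖) := by
  obtain ⟨M, hM⟩ := coef_le ha
  refine Summable.of_nonneg_of_le (fun n => by positivity) (fun n => ?_)
    ((summable_geometric_of_lt_one h0 h1).mul_right M)
  exact mul_le_mul_of_nonneg_left (hM n) (by positivity)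

lemma summ_eval {a : ℕ → ℚt} (ha : MemH2 a) {q : ℚt} (hq : ‖q‖ < 1) :
    Summable (fun n => q ^ n * a n) := by
  refine Summable.of_norm ?_
  simpa [norm_mul, norm_pow] using summ_pow ha (norm_nonneg q) hq

lemma evalS_slice {I : ℚt} (hI : I ∈ USphere) (a : ℕ → ℚt) (r t : ℝ) :
    evalS a ((r : ℚt) * ptOn I t) = ∑' n : ℕ, (r ^ n) • (ptOn I (n * t) * a n) := by
  simp only [evalS, slice_pow hI, smul_mul_assoc]

lemma norm_slice {I : ℚt} (hI : I ∈ USphere) (r t : ℝ) : ‖(r : ℚt) * ptOn I t‖ = |r| := by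
  rw [norm_mul, ptOn_norm hI]; simp

lemma evalS_contOn {a : ℕ → ℚt} (ha : MemH2 a) {ρ : ℝ} (h1 : ρ < 1) :
    ContinuousOn (evalS a) {q : ℚt | ‖q‖ ≤ ρ} := by
  rcases lt_or_ge ρ 0 with h | h0
  · have : {q : ℚt | ‖q‖ ≤ ρ} = ∅ := by
      ext q; simp; exact h.trans_le (norm_nonneg q)
    rw [this]; exact continuousOn_empty _
  refine continuousOn_tsum (fun n => by fun_prop) (summ_pow ha h0 h1) ?_
  intro n q hq
  rw [norm_mul, norm_pow]
  gcongr
  exact hq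

lemma evalS_cont_at {a : ℕ → ℚt} (ha : MemH2 a) {q : ℚt} (hq : ‖q‖ < 1) :
    ContinuousAt (evalS a) q := by
  obtain ⟨ρ, h1, h2⟩ := exists_between hq
  refine (evalS_contOn ha h2).continuousAt ?_
  filter_upwards [(isOpen_lt continuous_norm continuous_const).mem_nhds h1] with x hx
  exact le_of_lt hx


def qmk (x y z w : ℝ) : ℚt := ⟨x, y, z, w⟩
@[simp] lemma qmk_re (x y z w : ℝ) : (qmk x y z w).re = x := rfl
@[simp] lemma qmk_imI (x y z w : ℝ) : (qmk x y z w).imI = y := rfl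
@[simp] lemma qmk_imJ (x y z w : ℝ) : (qmk x y z w).imJ = z := rfl
@[simp] lemma qmk_imK (x y z w : ℝ) : (qmk x y z w).imK = w := rfl

lemma usphere_finite : μH[2] USphere < ∞ := by
  let g : (Fin 2 → ℝ) → ℚt := fun p =>
    (Real.sin (p 0) * Real.cos (p 1)) • qmk 0 1 0 0
      + (Real.sin (p 0) * Real.sin (p 1)) • qmk 0 0 1 0 + (Real.cos (p 0)) • qmk 0 0 0 1
  have hg : ContDiff ℝ 1 g := by
    have e0 : ContDiff ℝ 1 (fun p : Fin 2 → ℝ => p 0) := contDiff_apply ℝ ℝ 0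
    have e1 : ContDiff ℝ 1 (fun p : Fin 2 → ℝ => p 1) := contDiff_apply ℝ ℝ 1
    refine ContDiff.add (ContDiff.add ?_ ?_) ?_
    · exact (e0.sin.mul e1.cos).smul contDiff_const
    · exact (e0.sin.mul e1.sin).smul contDiff_const
    · exact e0.cos.smul contDiff_const
  let S : Set (Fin 2 → ℝ) := Set.Icc (fun _ => -Real.pi) (fun _ => Real.pi)
  have hSc : IsCompact S := isCompact_Icc
  obtain ⟨K, hK⟩ : ∃ K, LipschitzOnWith K g S :=
    (hg.locallyLipschitz.locallyLipschitzOn).exists_lipschitzOnWith_of_compact hSc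
  have hsub : USphere ⊆ g '' S := by
    intro q hq
    obtain ⟨h0, h1⟩ := (usphere_iff q).1 hq
    have hkk : q.imK ^ 2 ≤ 1 := by nlinarith [sq_nonneg q.imI, sq_nonneg q.imJ]
    have hk1 : -1 ≤ q.imK := by nlinarith
    have hk2 : q.imK ≤ 1 := by nlinarith
    let z : ℂ := ⟨q.imI, q.imJ⟩
    have hz : ‖z‖ = Real.sin (Real.arccos q.imK) := by
      rw [Real.sin_arccos]
      have : ‖z‖ ^ 2 = 1 - q.imK ^ 2 := by
        rw [← Complex.normSq_eq_norm_sq, Complex.normSq_apply]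
        simp only [z]
        linarith
      rw [← this, Real.sqrt_sq (norm_nonneg _)]
    refine ⟨![Real.arccos q.imK, Complex.arg z], ?_, ?_⟩
    · constructor
      · intro i
        fin_cases i
        · simpa using (neg_nonpos.2 Real.pi_pos.le).trans (Real.arccos_nonneg _)
        · simpa using (Complex.neg_pi_lt_arg z).le
      · intro i
        fin_cases i
        · simpa using (Real.arccos_le_pi _)
        · simpa using (Complex.arg_le_pi z)
    · have e1 := Complex.norm_mul_cos_arg z
      have e2 := Complex.norm_mul_sin_arg z
      simp only [g, Matrix.cons_val_zero, Matrix.cons_val_one, ← hz, e1, e2,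
        Real.cos_arccos hk1 hk2]
      ext <;> simp [z, h0]
  have h2 : μH[2] (g '' S) ≤ (K : ℝ≥0∞) ^ (2 : ℝ) * μH[2] S :=
    hK.hausdorffMeasure_image_le (by norm_num)
  have hvol : (μH[2] : Measure (Fin 2 → ℝ)) = volume := by
    have := @hausdorffMeasure_pi_real (Fin 2) _
    simpa using this
  refine (measure_mono hsub).trans_lt (h2.trans_lt ?_)
  rw [hvol]
  exact ENNReal.mul_lt_top (ENNReal.rpow_lt_top_of_nonneg (by norm_num) ENNReal.coe_ne_top)
    hSc.measure_lt_top

lemma comp_le_norm (q : ℚt) : |q.imI| ≤ ‖q‖ ∧ |q.imJ| ≤ ‖q‖ := by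
  have h := norm_sq_eq q
  constructor <;> refine abs_le_of_sq_le_sq ?_ (norm_nonneg _) <;> rw [h] <;>
    nlinarith [sq_nonneg q.re, sq_nonneg q.imI, sq_nonneg q.imJ, sq_nonneg q.imK]

lemma usphere_pos : 0 < μH[2] USphere := by
  let g : ℚt → (Fin 2 → ℝ) := fun q => ![q.imI, q.imJ]
  have hg : LipschitzWith 1 g := by
    refine LipschitzWith.of_dist_le_mul fun x y => ?_
    rw [NNReal.coe_one, one_mul, dist_pi_le_iff dist_nonneg]
    have := comp_le_norm (x - y)
    rw [dist_eq_norm x y]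
    intro i
    fin_cases i
    · simpa [g, Real.dist_eq] using this.1
    · simpa [g, Real.dist_eq] using this.2
  have hsub : Metric.ball (0 : Fin 2 → ℝ) (1 / 2) ⊆ g '' USphere := by
    intro p hp
    rw [Metric.mem_ball, dist_pi_lt_iff (by norm_num)] at hp
    have h0 := hp 0
    have h1 := hp 1
    simp only [Pi.zero_apply, Real.dist_eq, sub_zero] at h0 h1
    have h0' : p 0 ^ 2 ≤ 1 / 4 := by
      rw [← sq_abs]; nlinarith [abs_nonneg (p 0)]
    have h1' : p 1 ^ 2 ≤ 1 / 4 := by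
      rw [← sq_abs]; nlinarith [abs_nonneg (p 1)]
    refine ⟨qmk 0 (p 0) (p 1) (Real.sqrt (1 - p 0 ^ 2 - p 1 ^ 2)), ?_, ?_⟩
    · rw [usphere_iff]
      refine ⟨rfl, ?_⟩
      simp only [qmk_imI, qmk_imJ, qmk_imK]
      rw [Real.sq_sqrt (by linarith)]; ring
    · ext i
      fin_cases i <;> simp [g]
  have hvol : (μH[2] : Measure (Fin 2 → ℝ)) = volume := by
    have := @hausdorffMeasure_pi_real (Fin 2) _
    simpa using this
  have h1 : 0 < volume (Metric.ball (0 : Fin 2 → ℝ) (1 / 2)) :=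
    Metric.measure_ball_pos _ _ (by norm_num)
  have h2 := hg.hausdorffMeasure_image_le (d := 2) (by norm_num) USphere
  rw [hvol] at h2
  simp only [ENNReal.coe_one, ENNReal.one_rpow, one_mul] at h2
  exact h1.trans_le ((measure_mono hsub).trans h2)

instance sph_prob : IsProbabilityMeasure sphMeasure := by
  constructor
  rw [sphMeasure, Measure.smul_apply, Measure.restrict_apply MeasurableSet.univ, Set.univ_inter,
    smul_eq_mul]
  exact ENNReal.inv_mul_cancel usphere_pos.ne' usphere_finite.ne

lemma sph_ae_mem : ∀ᵐ I ∂sphMeasure, I ∈ USphere := by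
  unfold sphMeasure
  refine Measure.ae_smul_measure ?_ _
  exact ae_restrict_mem usphere_closed.measurableSet


lemma re_mul_comm (x y : ℚt) : (x * y).re = (y * x).re := by
  simp only [Quaternion.re_mul]; ring

lemma star_ptOn {I : ℚt} (hI : I ∈ USphere) (t : ℝ) : star (ptOn I t) = ptOn I (-t) := by
  have h := (usphere_iff I).1 hI
  ext <;> simp [ptOn, h.1]

lemma re_ptOn_mul (I : ℚt) (t : ℝ) (d : ℚt) :
    (ptOn I t * d).re = Real.cos t * d.re + Real.sin t * (I * d).re := by
  rw [ptOn, coe_eq_smul, add_mul, smul_mul_assoc, smul_mul_assoc, one_mul]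
  simp only [Quaternion.re_add, Quaternion.re_smul, smul_eq_mul]

lemma inner_ptOn {I : ℚt} (hI : I ∈ USphere) (s t : ℝ) (b c : ℚt) :
    inner ℝ (ptOn I s * b) (ptOn I t * c) =
      Real.cos (s - t) * (b * star c).re + Real.sin (s - t) * (I * (b * star c)).re := by
  rw [← re_ptOn_mul, Quaternion.inner_def, star_mul, star_ptOn hI, sub_eq_neg_add, ptOn_add hI,
    mul_assoc, re_mul_comm]
  rw [mul_assoc, mul_assoc, re_mul_comm]
  simp only [mul_assoc]
  rw [re_mul_comm]
  simp only [mul_assoc]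

lemma int_cos_int (k : ℤ) (hk : k ≠ 0) : ∫ t in (0 : ℝ)..(2 * Real.pi), Real.cos (k * t) = 0 := by
  have hk' : (k : ℝ) ≠ 0 := by exact_mod_cast hk
  rw [intervalIntegral.integral_comp_mul_left (fun x => Real.cos x) hk']
  simp only [mul_zero, integral_cos, Real.sin_zero, sub_zero]
  have : Real.sin ((k : ℝ) * (2 * Real.pi)) = 0 := by
    have := Real.sin_int_mul_pi (2 * k)
    push_cast at this
    rw [← this]; ring_nf
  rw [this, smul_zero]

lemma int_sin_int (k : ℤ) : ∫ t in (0 : ℝ)..(2 * Real.pi), Real.sin (k * t) = 0 := by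
  rcases eq_or_ne k 0 with rfl | hk
  · simp
  have hk' : (k : ℝ) ≠ 0 := by exact_mod_cast hk
  rw [intervalIntegral.integral_comp_mul_left (fun x => Real.sin x) hk']
  simp only [mul_zero, integral_sin, Real.cos_zero]
  have : Real.cos ((k : ℝ) * (2 * Real.pi)) = 1 := Real.cos_int_mul_two_pi k
  rw [this, sub_self, smul_zero]

lemma int_inner {I : ℚt} (hI : I ∈ USphere) (n m : ℕ) (b c : ℚt) :
    ∫ t in (0 : ℝ)..(2 * Real.pi), inner ℝ (ptOn I (n * t) * b) (ptOn I (m * t) * c) =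
      if n = m then 2 * Real.pi * (b * star c).re else 0 := by
  have h1 : ∀ t : ℝ, inner ℝ (ptOn I (n * t) * b) (ptOn I (m * t) * c) =
      Real.cos (((n - m : ℤ) : ℝ) * t) * (b * star c).re
        + Real.sin (((n - m : ℤ) : ℝ) * t) * (I * (b * star c)).re := by
    intro t
    rw [inner_ptOn hI]; push_cast; rw [sub_mul]
  simp only [h1]
  rw [intervalIntegral.integral_add, intervalIntegral.integral_mul_const,
    intervalIntegral.integral_mul_const, int_sin_int, zero_mul, add_zero]
  · split_ifs with h
    · subst h; simp
    · rw [int_cos_int _ (by omega), zero_mul]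
  · exact Continuous.intervalIntegrable (by fun_prop) _ _
  · exact Continuous.intervalIntegrable (by fun_prop) _ _

lemma cont_term (I : ℚt) (n : ℕ) (b : ℚt) : Continuous (fun t : ℝ => ptOn I (n * t) * b) := by
  have h : Continuous (fun t : ℝ => ptOn I (n * t)) :=
    (ptOn_cont I).comp (continuous_const.mul continuous_id)
  exact h.mul continuous_const

lemma cont_inner (I : ℚt) (n m : ℕ) (b c : ℚt) :
    Continuous (fun t : ℝ => (inner ℝ (ptOn I (n * t) * b) (ptOn I (m * t) * c) : ℝ)) :=
  (cont_term I n b).inner (cont_term I m c)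

lemma parseval_fin {I : ℚt} (hI : I ∈ USphere) (b : ℕ → ℚt) (N : ℕ) :
    ∫ t in (0 : ℝ)..(2 * Real.pi), ‖∑ n ∈ Finset.range N, ptOn I (n * t) * b n‖ ^ 2 =
      2 * Real.pi * ∑ n ∈ Finset.range N, ‖b n‖ ^ 2 := by
  simp only [← real_inner_self_eq_norm_sq (∑ n ∈ Finset.range N, _), sum_inner, inner_sum]
  rw [intervalIntegral.integral_finsetSum]
  · rw [Finset.mul_sum]
    refine Finset.sum_congr rfl fun n hn => ?_
    rw [intervalIntegral.integral_finsetSum]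
    · simp only [int_inner hI]
      rw [Finset.sum_eq_single n]
      · rw [if_pos rfl, ← Quaternion.inner_def, real_inner_self_eq_norm_sq]
      · intro m _ hm; rw [if_neg hm]
      · intro h; exact absurd hn h
    · intro m _
      exact Continuous.intervalIntegrable (cont_inner I m n _ _) _ _
  · intro n _
    refine Continuous.intervalIntegrable ?_ _ _
    exact continuous_finsetSum _ fun m _ => cont_inner I m n _ _

lemma norm_term {I : ℚt} (hI : I ∈ USphere) (s : ℝ) (b : ℚt) : ‖ptOn I s * b‖ = ‖b‖ := by
  rw [norm_mul, ptOn_norm hI, one_mul]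

lemma parseval {I : ℚt} (hI : I ∈ USphere) (b : ℕ → ℚt) (hb : Summable fun n => ‖b n‖) :
    ∫ t in (0 : ℝ)..(2 * Real.pi), ‖∑' n : ℕ, ptOn I (n * t) * b n‖ ^ 2 =
      2 * Real.pi * ∑' n, ‖b n‖ ^ 2 := by
  have hs : ∀ t : ℝ, Summable fun n : ℕ => ptOn I (n * t) * b n := fun t =>
    Summable.of_norm (by simpa only [norm_term hI] using hb)
  have hb2 : Summable fun n => ‖b n‖ ^ 2 := by
    have : Summable fun n => ‖b n‖ * ∑' m, ‖b m‖ := hb.mul_right _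
    refine Summable.of_nonneg_of_le (fun _ => by positivity) (fun n => ?_) this
    rw [pow_two]
    exact mul_le_mul_of_nonneg_left (hb.le_tsum n (fun _ _ => norm_nonneg _)) (norm_nonneg _)
  have h1 : Tendsto (fun N => ∫ t in (0 : ℝ)..(2 * Real.pi),
      ‖∑ n ∈ Finset.range N, ptOn I (n * t) * b n‖ ^ 2) atTop
      (𝓝 (∫ t in (0 : ℝ)..(2 * Real.pi), ‖∑' n : ℕ, ptOn I (n * t) * b n‖ ^ 2)) := by
    refine intervalIntegral.tendsto_integral_filter_of_dominated_convergence
      (fun _ => (∑' n, ‖b n‖) ^ 2) ?_ ?_ ?_ ?_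
    · refine Eventually.of_forall fun N => Continuous.aestronglyMeasurable ?_
      exact (continuous_finsetSum _ fun m _ => cont_term I m _).norm.pow 2
    · refine Eventually.of_forall fun N => Eventually.of_forall fun t _ => ?_
      rw [Real.norm_eq_abs, abs_of_nonneg (by positivity)]
      gcongr
      refine (norm_sum_le _ _).trans ?_
      simp only [norm_term hI]
      exact hb.sum_le_tsum _ (fun _ _ => norm_nonneg _)
    · simp
    · refine Eventually.of_forall fun t _ => ?_
      exact ((hs t).hasSum.tendsto_sum_nat.norm).pow 2
  simp only [parseval_fin hI] at h1
  exact tendsto_nhds_unique h1 (hb2.hasSum.tendsto_sum_nat.const_mul _)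

lemma evalS_slice' {I : ℚt} (hI : I ∈ USphere) (a : ℕ → ℚt) (r t : ℝ) :
    evalS a ((r : ℚt) * ptOn I t) = ∑' n : ℕ, ptOn I (n * t) * (r ^ n • a n) := by
  simp only [evalS_slice hI, mul_smul_comm]

lemma parseval_eval {I : ℚt} (hI : I ∈ USphere) {a : ℕ → ℚt} (ha : MemH2 a) {r : ℝ}
    (h0 : 0 ≤ r) (h1 : r < 1) :
    ∫ t in (0 : ℝ)..(2 * Real.pi), ‖evalS a ((r : ℚt) * ptOn I t)‖ ^ 2 =
      2 * Real.pi * ∑' n, (r ^ n * ‖a n‖) ^ 2 := by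
  simp only [evalS_slice' hI]
  rw [parseval hI]
  · simp only [norm_smul, norm_pow, Real.norm_eq_abs, abs_of_nonneg h0]
  · simpa only [norm_smul, norm_pow, Real.norm_eq_abs, abs_of_nonneg h0] using summ_pow ha h0 h1

/-- Abel-type convergence. -/
lemma abel_sq {a : ℕ → ℚt} (ha : MemH2 a) :
    Tendsto (fun r : ℝ => ∑' n, (r ^ n * ‖a n‖) ^ 2) (𝓝[<] 1) (𝓝 (h2normSq a)) := by
  refine tendsto_tsum_of_dominated_convergence (bound := fun n => ‖a n‖ ^ 2) ha ?_ ?_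
  · intro n
    have : Continuous (fun r : ℝ => (r ^ n * ‖a n‖) ^ 2) := by fun_prop
    have h2 := this.tendsto 1
    simp only [one_pow, one_mul] at h2
    exact h2.mono_left nhdsWithin_le_nhds
  · have : Set.Ioo (0 : ℝ) 1 ∈ 𝓝[<] (1 : ℝ) := Ioo_mem_nhdsLT (by norm_num)
    filter_upwards [this] with r hr n
    rw [Real.norm_eq_abs, abs_of_nonneg (by positivity)]
    have h0 : 0 ≤ r := hr.1.le
    gcongr
    exact mul_le_of_le_one_left (norm_nonneg _) (pow_le_one₀ h0 hr.2.le)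

lemma mem_ball_slice {I : ℚt} (hI : I ∈ USphere) {r : ℝ} (h0 : 0 ≤ r) (h1 : r < 1) (t : ℝ) :
    (r : ℚt) * ptOn I t ∈ QBall := by
  have : ‖(r : ℚt) * ptOn I t‖ < 1 := by rw [norm_slice hI, abs_of_nonneg h0]; exact h1
  exact this

lemma cont_slice {I : ℚt} (hI : I ∈ USphere) {a : ℕ → ℚt} (ha : MemH2 a) {r : ℝ}
    (h0 : 0 ≤ r) (h1 : r < 1) : Continuous (fun t : ℝ => evalS a ((r : ℚt) * ptOn I t)) := by
  refine continuous_iff_continuousAt.2 fun t => ?_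
  have h : ContinuousAt (evalS a) ((r : ℚt) * ptOn I t) :=
    evalS_cont_at ha (mem_ball_slice hI h0 h1 t)
  have h2 : ContinuousAt (fun t : ℝ => (r : ℚt) * ptOn I t) t :=
    (continuous_const.mul (ptOn_cont I)).continuousAt
  exact ContinuousAt.comp (g := evalS a) h h2

/-- comparision of slice means: if `‖g‖ ≤ ‖h‖` on slice `I` then the same for the norms. -/
lemma h2_le_of_slice {I : ℚt} (hI : I ∈ USphere) {a b : ℕ → ℚt} (ha : MemH2 a) (hb : MemH2 b)
    (h : ∀ r : ℝ, 0 ≤ r → r < 1 → ∀ t : ℝ,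
      ‖evalS a ((r : ℚt) * ptOn I t)‖ ≤ ‖evalS b ((r : ℚt) * ptOn I t)‖) :
    h2normSq a ≤ h2normSq b := by
  refine le_of_tendsto_of_tendsto (abel_sq ha) (abel_sq hb) ?_
  have : Set.Ioo (0 : ℝ) 1 ∈ 𝓝[<] (1 : ℝ) := Ioo_mem_nhdsLT (by norm_num)
  filter_upwards [this] with r hr
  have h0 : 0 ≤ r := hr.1.le
  have hp := Real.pi_pos
  have : 2 * Real.pi * ∑' n, (r ^ n * ‖a n‖) ^ 2 ≤ 2 * Real.pi * ∑' n, (r ^ n * ‖b n‖) ^ 2 := by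
    rw [← parseval_eval hI ha h0 hr.2, ← parseval_eval hI hb h0 hr.2]
    refine intervalIntegral.integral_mono_on (by positivity) ?_ ?_ ?_
    · exact ((cont_slice hI ha h0 hr.2).norm.pow 2).intervalIntegrable _ _
    · exact ((cont_slice hI hb h0 hr.2).norm.pow 2).intervalIntegrable _ _
    · intro t _
      gcongr
      exact h r h0 hr.2 t
  exact le_of_mul_le_mul_left this (by positivity)

lemma memH2_const (c : ℚt) : MemH2 (constS c) := by
  refine summable_of_ne_finset_zero (s := {0}) fun n hn => ?_
  simp at hn
  simp [constS, hn]

lemma evalS_const (c q : ℚt) : evalS (constS c) q = c := by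
  unfold evalS
  rw [tsum_eq_single 0]
  · simp [constS]
  · intro n hn; simp [constS, hn]

lemma h2normSq_const (c : ℚt) : h2normSq (constS c) = ‖c‖ ^ 2 := by
  unfold h2normSq
  rw [tsum_eq_single 0]
  · simp [constS]
  · intro n hn; simp [constS, hn]

lemma h2_le_sup {a : ℕ → ℚt} (ha : MemH2 a) {S : ℝ} (hS : 0 ≤ S)
    (h : ∀ q ∈ QBall, ‖evalS a q‖ ≤ S) : h2normSq a ≤ S ^ 2 := by
  obtain ⟨I, hI, _⟩ := exists_slice 1
  have := h2_le_of_slice hI ha (memH2_const (S : ℚt)) (fun r h0 h1 t => by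
    rw [evalS_const]
    simpa [abs_of_nonneg hS] using h _ (mem_ball_slice hI h0 h1 t))
  rw [h2normSq_const] at this
  simpa using this


/-- coefficient sequence of `q^k * f`. -/
noncomputable def shS (k : ℕ) (a : ℕ → ℚt) : ℕ → ℚt := fun n => if k ≤ n then a (n - k) else 0

/-- left multiplication of the coefficients. -/
noncomputable def lmS (c : ℚt) (a : ℕ → ℚt) : ℕ → ℚt := fun n => c * a n

lemma shS_add (k : ℕ) (a : ℕ → ℚt) (n : ℕ) : shS k a (n + k) = a n := by
  simp [shS]

lemma shS_lt (k : ℕ) (a : ℕ → ℚt) {n : ℕ} (h : n < k) : shS k a n = 0 := by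
  simp [shS, h]

lemma hasSum_shift {E : Type*} [NormedAddCommGroup E] (k : ℕ) (f : ℕ → E) (h : ∀ n < k, f n = 0)
    {s : E} (hs : HasSum (fun n => f (n + k)) s) : HasSum f s := by
  rw [hasSum_nat_add_iff] at hs
  rwa [Finset.sum_eq_zero, add_zero] at hs
  intro n hn; exact h n (Finset.mem_range.1 hn)

lemma memH2_sh (k : ℕ) {a : ℕ → ℚt} (ha : MemH2 a) : MemH2 (shS k a) := by
  refine (hasSum_shift k _ ?_ (s := h2normSq a) ?_).summable
  · intro n hn; simp [shS_lt k a hn]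
  · simp only [shS_add]
    exact ha.hasSum

lemma h2normSq_sh (k : ℕ) {a : ℕ → ℚt} (ha : MemH2 a) : h2normSq (shS k a) = h2normSq a := by
  refine (hasSum_shift k _ ?_ (s := h2normSq a) ?_).tsum_eq
  · intro n hn; simp [shS_lt k a hn]
  · simp only [shS_add]
    exact ha.hasSum

lemma memH2_lm (c : ℚt) {a : ℕ → ℚt} (ha : MemH2 a) : MemH2 (lmS c a) := by
  unfold MemH2 lmS
  simp only [norm_mul, mul_pow]
  exact ha.mul_left _

lemma h2normSq_lm (c : ℚt) (a : ℕ → ℚt) : h2normSq (lmS c a) = ‖c‖ ^ 2 * h2normSq a := by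
  unfold h2normSq lmS
  simp only [norm_mul, mul_pow]
  exact tsum_mul_left

lemma memH2_add {a b : ℕ → ℚt} (ha : MemH2 a) (hb : MemH2 b) : MemH2 (a + b) := by
  refine Summable.of_nonneg_of_le (fun n => by positivity) (fun n => ?_)
    ((ha.mul_left 2).add (hb.mul_left 2))
  have h1 : ‖(a + b) n‖ ≤ ‖a n‖ + ‖b n‖ := norm_add_le _ _
  have h2 := norm_nonneg ((a + b) n)
  nlinarith [sq_nonneg (‖a n‖ - ‖b n‖)]

lemma memH2_sum {ι : Type*} (s : Finset ι) (g : ι → ℕ → ℚt) (h : ∀ i ∈ s, MemH2 (g i)) :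
    MemH2 (∑ i ∈ s, g i) := by
  induction s using Finset.induction_on with
  | empty => simp [MemH2, summable_zero]
  | insert i s hi ih =>
    rw [Finset.sum_insert hi]
    exact memH2_add (h i (by simp)) (ih fun j hj => h j (by simp [hj]))

lemma evalS_add {a b : ℕ → ℚt} (ha : MemH2 a) (hb : MemH2 b) {q : ℚt} (hq : ‖q‖ < 1) :
    evalS (a + b) q = evalS a q + evalS b q := by
  unfold evalS
  rw [← (summ_eval ha hq).tsum_add (summ_eval hb hq)]
  simp [mul_add]

lemma evalS_sum {ι : Type*} (s : Finset ι) (g : ι → ℕ → ℚt) (h : ∀ i ∈ s, MemH2 (g i)) {q : ℚt}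
    (hq : ‖q‖ < 1) : evalS (∑ i ∈ s, g i) q = ∑ i ∈ s, evalS (g i) q := by
  induction s using Finset.induction_on with
  | empty => simp [evalS]
  | insert i s hi ih =>
    rw [Finset.sum_insert hi, Finset.sum_insert hi, evalS_add (h i (by simp))
      (memH2_sum _ _ fun j hj => h j (by simp [hj])) hq, ih fun j hj => h j (by simp [hj])]

lemma evalS_sh (k : ℕ) {a : ℕ → ℚt} (ha : MemH2 a) {q : ℚt} (hq : ‖q‖ < 1) :
    evalS (shS k a) q = q ^ k * evalS a q := by
  refine (hasSum_shift k _ ?_ ?_).tsum_eq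
  · intro n hn; simp [shS_lt k a hn]
  · have := (summ_eval ha hq).hasSum.mul_left (q ^ k)
    have e : ∀ n, q ^ (n + k) * shS k a (n + k) = q ^ k * (q ^ n * a n) := by
      intro n
      rw [shS_add, ← mul_assoc, ← pow_add, add_comm k]
    simp only [e]
    exact this

lemma evalS_lm {c : ℚt} {a : ℕ → ℚt} (ha : MemH2 a) {q : ℚt} (hq : ‖q‖ < 1) (hc : Commute c q) :
    evalS (lmS c a) q = c * evalS a q := by
  unfold evalS lmS
  rw [← (summ_eval ha hq).tsum_mul_left]
  congr 1; ext1 n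
  rw [← mul_assoc, ← mul_assoc, (hc.pow_right n).eq]

lemma sProd_eq (k : ℕ) (l : ℚt) (a : ℕ → ℚt) :
    sProd (fun n => qpow k n + constS l n) a = shS k a + lmS l a := by
  funext n
  simp only [sProd, add_mul, Finset.sum_add_distrib, Pi.add_apply]
  congr 1
  · simp only [qpow, ite_mul, one_mul, zero_mul, Finset.sum_ite_eq', Finset.mem_range, shS,
      Nat.lt_succ_iff]
  · simp [constS, lmS]

lemma memH2_qpow (k : ℕ) : MemH2 (qpow k) := by
  refine summable_of_ne_finset_zero (s := {k}) fun n hn => ?_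
  simp at hn
  simp [qpow, hn]

lemma evalS_qpow (k : ℕ) (q : ℚt) : evalS (qpow k) q = q ^ k := by
  unfold evalS
  rw [tsum_eq_single k]
  · simp [qpow]
  · intro n hn; simp [qpow, hn]

lemma slice_commute {I : ℚt} (hI : I ∈ USphere) (r t ρ s : ℝ) :
    Commute ((r : ℚt) * ptOn I t) ((ρ : ℚt) * ptOn I s) := by
  have h : Commute (ptOn I t) (ptOn I s) := by
    unfold Commute SemiconjBy
    rw [← ptOn_add hI, ← ptOn_add hI, add_comm]
  exact ((show Commute (r : ℚt) ((ρ : ℚt) * ptOn I s) from coe_comm r _).mul_left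
    ((show Commute (ptOn I t) (ρ : ℚt) from (coe_comm ρ _).symm).mul_right h))

/-- (ii) implies (iii). -/
lemma two_three {a : ℕ → ℚt} (ha : MemH2 a) (h : ∀ q ∈ QBall, ‖evalS a q‖ ≤ 1) (k : ℕ) (l : ℚt) :
    h2norm (sProd (fun n => qpow k n + constS l n) a) ≤
          h2norm (fun n => qpow k n + constS l n) := by
  rw [sProd_eq]
  refine Real.sqrt_le_sqrt ?_
  obtain ⟨I, hI, s, hs⟩ := exists_slice l
  have hm : MemH2 (qpow k + constS l) := memH2_add (memH2_qpow k) (memH2_const l)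
  refine h2_le_of_slice hI (memH2_add (memH2_sh k ha) (memH2_lm l ha)) hm ?_
  intro r h0 h1 t
  have hb := mem_ball_slice hI h0 h1 t
  have hc : Commute l ((r : ℚt) * ptOn I t) := by
    rw [hs]; exact slice_commute hI _ _ _ _
  have e : evalS (fun n => qpow k n + constS l n) ((r : ℚt) * ptOn I t)
      = ((r : ℚt) * ptOn I t) ^ k + l := by
    have := evalS_add (memH2_qpow k) (memH2_const l) hb
    rw [evalS_qpow, evalS_const] at this
    exact this
  rw [e, evalS_add (memH2_sh k ha) (memH2_lm l ha) hb, evalS_sh k ha hb, evalS_lm ha hb hc,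
    ← add_mul, norm_mul]
  exact mul_le_of_le_one_right (norm_nonneg _) (h _ hb)

/-- vector in `ℓ²`. -/
noncomputable def toV (a : ℕ → ℚt) (ha : MemH2 a) : lp (fun _ : ℕ => ℚt) 2 :=
  ⟨a, by
    refine memℓp_gen ?_
    have : Summable (fun n => ‖a n‖ ^ 2) := ha
    simpa using this⟩

lemma toV_inner {a b : ℕ → ℚt} (ha : MemH2 a) (hb : MemH2 b) :
    HasSum (fun n => inner ℝ (a n) (b n)) (inner ℝ (toV a ha) (toV b hb)) :=
  lp.hasSum_inner (𝕜 := ℝ) (toV a ha) (toV b hb)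

lemma toV_norm {a : ℕ → ℚt} (ha : MemH2 a) : ‖toV a ha‖ ^ 2 = h2normSq a := by
  rw [← real_inner_self_eq_norm_sq]
  have := toV_inner ha ha
  simp only [real_inner_self_eq_norm_sq (_ : ℚt)] at this
  exact this.unique ha.hasSum

lemma h2normSq_add {a b : ℕ → ℚt} (ha : MemH2 a) (hb : MemH2 b) :
    h2normSq (a + b) = h2normSq a + 2 * (∑' n, inner ℝ (a n) (b n)) + h2normSq b := by
  have h : toV (a + b) (memH2_add ha hb) = toV a ha + toV b hb := rfl
  rw [← toV_norm (memH2_add ha hb), h, norm_add_sq_real, toV_norm, toV_norm,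
    (toV_inner ha hb).tsum_eq]

lemma inner_zero_of_three {a : ℕ → ℚt} (ha : MemH2 a) (h1 : h2normSq a = 1)
    (h : ∀ (k : ℕ) (l : ℚt), h2norm (sProd (fun n => qpow k n + constS l n) a) ≤
          h2norm (fun n => qpow k n + constS l n)) (k : ℕ) (hk : 1 ≤ k) (l : ℚt) :
    ∑' n, inner ℝ (shS k a n) (lmS l a n) = (0 : ℝ) := by
  have key : ∀ l : ℚt, ∑' n, inner ℝ (shS k a n) (lmS l a n) ≤ (0 : ℝ) := by
    intro l
    have h2 := h k l
    rw [sProd_eq] at h2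
    have hn : 0 ≤ h2normSq (fun n => qpow k n + constS l n) := tsum_nonneg fun n => by positivity
    have h3 := (Real.sqrt_le_sqrt_iff hn).1 h2
    have e : h2normSq (fun n => qpow k n + constS l n) = 1 + ‖l‖ ^ 2 := by
      have := h2normSq_add (memH2_qpow k) (memH2_const l)
      have e1 : h2normSq (qpow k) = 1 := by
        unfold h2normSq
        rw [tsum_eq_single k]
        · simp [qpow]
        · intro n hn; simp [qpow, hn]
      have e2 : ∑' n, inner ℝ (qpow k n) (constS l n) = (0 : ℝ) := by
        rw [← tsum_zero]
        congr 1; ext1 n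
        by_cases hn : n = 0
        · subst hn
          have : (0 : ℕ) ≠ k := by omega
          simp only [qpow, if_neg this, inner_zero_left]
        · simp only [constS, if_neg hn, inner_zero_right]
      rw [e1, e2, h2normSq_const] at this
      rw [mul_zero, add_zero] at this
      exact this
    rw [e, h2normSq_add (memH2_sh k ha) (memH2_lm l ha), h2normSq_sh k ha, h2normSq_lm, h1] at h3
    linarith
  refine le_antisymm (key l) ?_
  have := key (-l)
  have e : ∑' n, inner ℝ (shS k a n) (lmS (-l) a n) = -∑' n, inner ℝ (shS k a n) (lmS l a n) := by
    rw [← tsum_neg]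
    congr 1; ext1 n
    simp only [lmS, neg_mul, inner_neg_right]
  rw [e] at this
  linarith

lemma inner_lm (c d x y : ℚt) : inner ℝ (c * x) (d * y) = inner ℝ x ((star c * d) * y) := by
  simp only [Quaternion.inner_def, star_mul, star_star]
  rw [mul_assoc, re_mul_comm]
  simp only [mul_assoc]

lemma inner_zero_gen {a : ℕ → ℚt}
    (h : ∀ (k : ℕ), 1 ≤ k → ∀ l : ℚt, ∑' n, inner ℝ (shS k a n) (lmS l a n) = (0 : ℝ))
    (ha : MemH2 a) {i j : ℕ} (hij : i < j) (c d : ℚt) :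
    ∑' n, inner ℝ (lmS c (shS j a) n) (lmS d (shS i a) n) = (0 : ℝ) := by
  have h1 := h (j - i) (by omega) (star c * d)
  have hs := (toV_inner (memH2_sh (j - i) ha) (memH2_lm (star c * d) ha))
  rw [← hs.tsum_eq, h1] at hs
  refine (hasSum_shift i _ ?_ ?_).tsum_eq
  · intro n hn; simp [lmS, shS_lt i a hn]
  · have e : ∀ n, inner ℝ (lmS c (shS j a) (n + i)) (lmS d (shS i a) (n + i))
        = inner ℝ (shS (j - i) a n) (lmS (star c * d) a n) := by
      intro n
      have e2 : shS j a (n + i) = shS (j - i) a n := by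
        by_cases hn : j - i ≤ n
        · have : j ≤ n + i := by omega
          simp only [shS, if_pos hn, if_pos this]
          congr 1; omega
        · have : ¬ j ≤ n + i := by omega
          simp only [shS, if_neg hn, if_neg this]
      rw [← e2]
      simp only [lmS, shS_add, inner_lm]
    simp only [e]
    exact hs

lemma h2normSq_poly {a : ℕ → ℚt} (ha : MemH2 a) (h1 : h2normSq a = 1)
    (h : ∀ (k : ℕ), 1 ≤ k → ∀ l : ℚt, ∑' n, inner ℝ (shS k a n) (lmS l a n) = (0 : ℝ))
    (c : ℕ → ℚt) (N : ℕ) :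
    h2normSq (∑ j ∈ Finset.range N, lmS (c j) (shS j a)) = ∑ j ∈ Finset.range N, ‖c j‖ ^ 2 := by
  have hm : ∀ j, MemH2 (lmS (c j) (shS j a)) := fun j => memH2_lm _ (memH2_sh _ ha)
  induction N with
  | zero => simp [h2normSq]
  | succ N ih =>
    rw [Finset.sum_range_succ, Finset.sum_range_succ, add_comm,
      h2normSq_add (hm N) (memH2_sum _ _ fun j _ => hm j), ih, h2normSq_lm, h2normSq_sh N ha, h1]
    have : ∑' n, inner ℝ (lmS (c N) (shS N a) n) ((∑ j ∈ Finset.range N, lmS (c j) (shS j a)) n)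
        = (0 : ℝ) := by
      simp only [Finset.sum_apply, inner_sum]
      rw [Summable.tsum_finsetSum]
      · refine Finset.sum_eq_zero fun j hj => ?_
        exact inner_zero_gen h ha (Finset.mem_range.1 hj) _ _
      · intro j _
        exact (toV_inner (hm N) (hm j)).summable
    rw [this]; ring

lemma eval_bound {g : ℕ → ℚt} (hg : MemH2 g) {q : ℚt} (hq : ‖q‖ < 1) :
    ‖evalS g q‖ ≤ ((∑' n : ℕ, (‖q‖ ^ 2) ^ n) + h2normSq g) / 2 := by
  have hq2 : ‖q‖ ^ 2 < 1 := by nlinarith [norm_nonneg q]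
  have hs := summable_geometric_of_lt_one (sq_nonneg ‖q‖) hq2
  have hh : HasSum (fun n : ℕ => ((‖q‖ ^ 2) ^ n + ‖g n‖ ^ 2) / 2)
      (((∑' n : ℕ, (‖q‖ ^ 2) ^ n) + h2normSq g) / 2) := (hs.hasSum.add hg.hasSum).div_const 2
  refine tsum_of_norm_bounded hh fun n => ?_
  rw [norm_mul, norm_pow, ← pow_mul, mul_comm 2 n, pow_mul]
  nlinarith [sq_nonneg (‖q‖ ^ n - ‖g n‖)]

/-- (iii) implies boundedness. -/
lemma three_bound {a : ℕ → ℚt} (ha : MemH2 a) (h1 : h2normSq a = 1)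
    (h : ∀ (k : ℕ) (l : ℚt), h2norm (sProd (fun n => qpow k n + constS l n) a) ≤
          h2norm (fun n => qpow k n + constS l n)) : ∀ q ∈ QBall, ‖evalS a q‖ ≤ 1 := by
  intro q hq
  have hq : ‖q‖ < 1 := hq
  have hq2 : ‖q‖ ^ 2 < 1 := by nlinarith [norm_nonneg q]
  have hs := summable_geometric_of_lt_one (sq_nonneg ‖q‖) hq2
  set S := ∑' n : ℕ, (‖q‖ ^ 2) ^ n with hS
  have hcomm : Commute (star q) q := by
    unfold Commute SemiconjBy
    rw [Quaternion.star_mul_self, Quaternion.self_mul_star]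
  have hN : ∀ N : ℕ, (∑ j ∈ Finset.range N, (‖q‖ ^ 2) ^ j) * ‖evalS a q‖ ≤
      (S + ∑ j ∈ Finset.range N, (‖q‖ ^ 2) ^ j) / 2 := by
    intro N
    have hm : ∀ j, MemH2 (lmS (star q ^ j) (shS j a)) := fun j => memH2_lm _ (memH2_sh _ ha)
    have hb := eval_bound (memH2_sum (Finset.range N) _ fun j _ => hm j) hq
    rw [h2normSq_poly ha h1 (fun k hk l => inner_zero_of_three ha h1 h k hk l),
      evalS_sum _ _ (fun j _ => hm j) hq] at hb
    have e : ∀ j, evalS (lmS (star q ^ j) (shS j a)) q = ((‖q‖ ^ 2) ^ j) • evalS a q := by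
      intro j
      rw [evalS_lm (memH2_sh _ ha) hq (hcomm.pow_left j), evalS_sh _ ha hq, ← mul_assoc,
        ← hcomm.mul_pow, Quaternion.star_mul_self, Quaternion.normSq_eq_norm_mul_self, ← pow_two,
        ← Quaternion.coe_pow, coe_eq_smul, smul_mul_assoc, one_mul]
    simp only [e, ← Finset.sum_smul, norm_smul, norm_pow, norm_star] at hb
    rw [Real.norm_of_nonneg (Finset.sum_nonneg fun _ _ => by positivity)] at hb
    have e3 : ∀ j : ℕ, (‖q‖ ^ j) ^ 2 = (‖q‖ ^ 2) ^ j := fun j => by ring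
    simp only [e3] at hb
    exact hb
  have hlim := hs.hasSum.tendsto_sum_nat
  have h2 := le_of_tendsto_of_tendsto (hlim.mul_const ‖evalS a q‖)
    ((hlim.const_add S).div_const 2) (Eventually.of_forall hN)
  have hS1 : 1 ≤ S := by
    have := hs.le_tsum 0 (fun _ _ => by positivity)
    simpa using this
  rw [← hS] at h2
  nlinarith


/-- coefficients of the boundary primitive -/
noncomputable def prc (I : ℚt) (a : ℕ → ℚt) (n : ℕ) : ℚt := ((n : ℝ) + 1)⁻¹ • (-I * a (n + 1))

/-- boundary primitive -/
noncomputable def prim (I : ℚt) (a : ℕ → ℚt) (t : ℝ) : ℚt :=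
  ∑' n : ℕ, ptOn I (((n + 1 : ℕ) : ℝ) * t) * prc I a n

lemma norm_prc {I : ℚt} (hI : I ∈ USphere) (a : ℕ → ℚt) (n : ℕ) :
    ‖prc I a n‖ = ((n : ℝ) + 1)⁻¹ * ‖a (n + 1)‖ := by
  have h : (0 : ℝ) ≤ ((n : ℝ) + 1)⁻¹ := by positivity
  rw [prc, norm_smul, norm_mul, norm_neg, usphere_norm hI, one_mul, Real.norm_of_nonneg h]

lemma summ_prc {I : ℚt} (hI : I ∈ USphere) {a : ℕ → ℚt} (ha : MemH2 a) :
    Summable (fun n => ‖prc I a n‖) := by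
  have h1 : Summable (fun n : ℕ => (((n : ℝ) + 1)⁻¹) ^ 2) := by
    have := (summable_nat_add_iff 1).2 (Real.summable_nat_pow_inv.2 (by norm_num : 1 < 2))
    simpa using this
  have h2 : Summable (fun n => ‖a (n + 1)‖ ^ 2) := (summable_nat_add_iff 1).2 ha
  refine Summable.of_nonneg_of_le (fun _ => norm_nonneg _) (fun n => ?_) (h1.add h2)
  rw [norm_prc hI]
  have h : (0 : ℝ) ≤ ((n : ℝ) + 1)⁻¹ := by positivity
  have h' := norm_nonneg (a (n + 1))
  nlinarith [sq_nonneg (((n : ℝ) + 1)⁻¹ - ‖a (n + 1)‖), mul_nonneg h h']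

lemma ptOn_comm (I : ℚt) (t : ℝ) : ptOn I t * I = I * ptOn I t := by
  simp only [ptOn, coe_eq_smul, mul_add, add_mul, smul_mul_assoc, mul_smul_comm, one_mul, mul_one]

lemma deriv_coef {I : ℚt} (hI : I ∈ USphere) (a : ℕ → ℚt) (n : ℕ) (s : ℝ) :
    ((n + 1 : ℕ) : ℝ) • (I * ptOn I s * prc I a n) = ptOn I s * a (n + 1) := by
  have h : ((n : ℝ) + 1) ≠ 0 := by positivity
  rw [prc, mul_smul_comm, smul_smul]
  push_cast
  rw [mul_inv_cancel₀ h, one_smul, ← ptOn_comm]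
  rw [neg_mul, mul_neg, mul_assoc, ← mul_assoc I I, usphere_mul_self hI]
  simp

lemma evalS_tail {I : ℚt} (hI : I ∈ USphere) {a : ℕ → ℚt} (ha : MemH2 a) {r : ℝ} (h0 : 0 ≤ r)
    (h1 : r < 1) (t : ℝ) : evalS a ((r : ℚt) * ptOn I t) - a 0 =
      ∑' n : ℕ, r ^ (n + 1) • (ptOn I (((n + 1 : ℕ) : ℝ) * t) * a (n + 1)) := by
  have hb : ‖(r : ℚt) * ptOn I t‖ < 1 := mem_ball_slice hI h0 h1 t
  have hs := summ_eval ha hb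
  simp only [slice_pow hI, smul_mul_assoc] at hs
  rw [evalS_slice hI, hs.tsum_eq_zero_add]
  simp [ptOn_zero]

lemma ptOn_mul_deriv {I : ℚt} (hI : I ∈ USphere) (c : ℝ) (t : ℝ) :
    HasDerivAt (fun t => ptOn I (c * t)) (c • (I * ptOn I (c * t))) t := by
  have h1 : HasDerivAt (fun t : ℝ => c * t) c t := by simpa using (hasDerivAt_id t).const_mul c
  exact (ptOn_hasDeriv hI (c * t)).scomp t h1

lemma prim_lip {I : ℚt} (hI : I ∈ USphere) {a : ℕ → ℚt} (ha : MemH2 a) {C : ℝ}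
    (hC : ∀ q ∈ QBall, ‖evalS a q‖ ≤ C) :
    ∃ K, LipschitzWith K (prim I a) := by
  have hC0 : 0 ≤ C := (norm_nonneg _).trans (hC _ (mem_ball_slice hI le_rfl one_pos 0))
  let K : NNReal := ⟨C + ‖a 0‖, by positivity⟩
  refine ⟨K, LipschitzWith.of_dist_le_mul fun s t => ?_⟩
  let Gr : ℝ → ℝ → ℚt := fun r t =>
    ∑' n : ℕ, r ^ (n + 1) • (ptOn I (((n + 1 : ℕ) : ℝ) * t) * prc I a n)
  have hIoo : Set.Ioo (0 : ℝ) 1 ∈ 𝓝[<] (1 : ℝ) := Ioo_mem_nhdsLT (by norm_num)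
  have hlip : ∀ r ∈ Set.Ioo (0 : ℝ) 1, ∀ s t, dist (Gr r s) (Gr r t) ≤ K * dist s t := by
    intro r hr s t
    have h0 : 0 ≤ r := hr.1.le
    have hsum : Summable (fun n : ℕ => r ^ (n + 1) * ‖a (n + 1)‖) :=
      (summable_nat_add_iff 1).2 (summ_pow ha h0 hr.2)
    have hd : ∀ t, HasDerivAt (Gr r) (evalS a ((r : ℚt) * ptOn I t) - a 0) t := by
      intro t
      rw [evalS_tail hI ha h0 hr.2]
      refine hasDerivAt_tsum (𝕜 := ℝ) (F := ℚt)
        (g := fun (n : ℕ) (t : ℝ) => r ^ (n + 1) • (ptOn I (((n + 1 : ℕ) : ℝ) * t) * prc I a n))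
        (g' := fun (n : ℕ) (t : ℝ) => r ^ (n + 1) • (ptOn I (((n + 1 : ℕ) : ℝ) * t) * a (n + 1)))
        (y₀ := (0 : ℝ)) hsum (fun n x => ?_) (fun n x => ?_) ?_ t
      · have := ((ptOn_mul_deriv hI ((n + 1 : ℕ) : ℝ) x).mul_const (prc I a n)).const_smul
          (r ^ (n + 1))
        rw [smul_mul_assoc, deriv_coef hI] at this
        exact this
      · rw [norm_smul, norm_term hI, Real.norm_of_nonneg (by positivity)]
      · refine Summable.of_norm ?_
        simp only [norm_smul, norm_term hI]
        refine Summable.of_nonneg_of_le (fun _ => by positivity) (fun n => ?_) (summ_prc hI ha)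
        rw [Real.norm_of_nonneg (by positivity)]
        exact mul_le_of_le_one_left (norm_nonneg _) (pow_le_one₀ h0 hr.2.le)
    have : LipschitzWith K (Gr r) := by
      refine lipschitzWith_of_nnnorm_deriv_le (fun t => (hd t).differentiableAt) fun t => ?_
      rw [(hd t).deriv, ← NNReal.coe_le_coe]
      refine (norm_sub_le _ _).trans ?_
      exact add_le_add_left (hC _ (mem_ball_slice hI h0 hr.2 t)) _
    exact this.dist_le_mul s t
  have hlim : ∀ t, Tendsto (fun r => Gr r t) (𝓝[<] 1) (𝓝 (prim I a t)) := by
    intro t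
    refine tendsto_tsum_of_dominated_convergence (bound := fun n => ‖prc I a n‖)
      (summ_prc hI ha) ?_ ?_
    · intro n
      have : Continuous (fun r : ℝ => r ^ (n + 1) • (ptOn I (((n + 1 : ℕ) : ℝ) * t) * prc I a n)) :=
        (continuous_pow (n + 1)).smul continuous_const
      have h2 := this.tendsto 1
      simp only [one_pow, one_smul] at h2
      exact h2.mono_left nhdsWithin_le_nhds
    · filter_upwards [hIoo] with r hr n
      have h0 : 0 ≤ r := hr.1.le
      rw [norm_smul, norm_term hI, Real.norm_of_nonneg (by positivity)]
      exact mul_le_of_le_one_left (norm_nonneg _) (pow_le_one₀ h0 hr.2.le)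
  refine le_of_tendsto ((hlim s).dist (hlim t)) ?_
  filter_upwards [hIoo] with r hr
  exact hlip r hr s t

/-- the kernel -/
noncomputable def Qk (r s : ℝ) : ℝ :=
  r * (1 - r ^ 2) * Real.sin s / (1 - 2 * r * Real.cos s + r ^ 2) ^ 2

lemma den_pos {r : ℝ} (h0 : 0 ≤ r) (h1 : r < 1) (s : ℝ) : 0 < 1 - 2 * r * Real.cos s + r ^ 2 := by
  nlinarith [Real.cos_le_one s, mul_nonneg h0 (sub_nonneg.2 (Real.cos_le_one s)),
    sq_pos_of_pos (sub_pos.2 h1)]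

lemma Qk_cont {r : ℝ} (h0 : 0 ≤ r) (h1 : r < 1) : Continuous (Qk r) := by
  unfold Qk
  refine Continuous.div (by fun_prop) (by fun_prop) fun s => ?_
  exact pow_ne_zero _ (den_pos h0 h1 s).ne'

lemma Qk_hasSum {r : ℝ} (h0 : 0 ≤ r) (h1 : r < 1) (s : ℝ) :
    HasSum (fun n : ℕ => (n : ℝ) * r ^ n * Real.sin (n * s)) (Qk r s) := by
  set z : ℂ := r * Complex.exp (s * Complex.I) with hz
  have hzn : ‖z‖ < 1 := by
    rw [hz, norm_mul, Complex.norm_exp_ofReal_mul_I, mul_one, Complex.norm_real,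
      Real.norm_of_nonneg h0]
    exact h1
  have h := (hasSum_coe_mul_geometric_of_norm_lt_one hzn).mapL Complex.imCLM
  have e1 : ∀ n : ℕ, Complex.imCLM ((n : ℂ) * z ^ n) = (n : ℝ) * r ^ n * Real.sin (n * s) := by
    intro n
    have : (n : ℂ) * z ^ n = (((n : ℝ) * r ^ n : ℝ) : ℂ) * Complex.exp (((n * s : ℝ) : ℂ) * Complex.I) := by
      rw [hz, mul_pow, ← Complex.exp_nat_mul]
      push_cast
      rw [mul_assoc, mul_assoc]
    rw [this, Complex.imCLM_apply, Complex.im_ofReal_mul, Complex.exp_ofReal_mul_I_im]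
  have e2 : Complex.imCLM (z / (1 - z) ^ 2) = Qk r s := by
    have zr : z.re = r * Real.cos s := by
      rw [hz, Complex.re_ofReal_mul, Complex.exp_ofReal_mul_I_re]
    have zi : z.im = r * Real.sin s := by
      rw [hz, Complex.im_ofReal_mul, Complex.exp_ofReal_mul_I_im]
    have hcs := Real.sin_sq_add_cos_sq s
    have hn : Complex.normSq ((1 - z) ^ 2) = (1 - 2 * r * Real.cos s + r ^ 2) ^ 2 := by
      rw [map_pow, Complex.normSq_apply]
      simp only [Complex.sub_re, Complex.one_re, Complex.sub_im, Complex.one_im, zr, zi]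
      congr 1
      linear_combination r ^ 2 * hcs
    rw [Complex.imCLM_apply, Complex.div_im, hn, ← sub_div, Qk]
    congr 1
    simp only [pow_two, Complex.mul_re, Complex.mul_im, Complex.sub_re, Complex.one_re,
      Complex.sub_im, Complex.one_im, zr, zi]
    linear_combination (-(r ^ 3) * Real.sin s) * hcs
  rw [e2] at h
  simpa only [e1] using h

lemma int_cos_pi (k : ℤ) : ∫ t in (-Real.pi)..Real.pi, Real.cos (k * t)
    = if k = 0 then 2 * Real.pi else 0 := by
  split_ifs with hk
  · subst hk; simp; ring
  have hk' : (k : ℝ) ≠ 0 := by exact_mod_cast hk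
  rw [intervalIntegral.integral_comp_mul_left (fun x => Real.cos x) hk']
  simp only [integral_cos, mul_neg, Real.sin_neg, Real.sin_int_mul_pi, neg_zero, sub_zero, smul_zero]

lemma int_sin_sin (n m : ℕ) (hm : 1 ≤ m) :
    ∫ t in (-Real.pi)..Real.pi, Real.sin (n * t) * Real.sin (m * t)
      = if n = m then Real.pi else 0 := by
  have h1 : ∀ t : ℝ, Real.sin (n * t) * Real.sin (m * t) =
      (1 / 2) * Real.cos (((n - m : ℤ) : ℝ) * t) - (1 / 2) * Real.cos (((n + m : ℤ) : ℝ) * t) := by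
    intro t
    push_cast
    rw [sub_mul, add_mul, Real.cos_sub, Real.cos_add]; ring
  simp only [h1]
  rw [intervalIntegral.integral_sub, intervalIntegral.integral_const_mul,
    intervalIntegral.integral_const_mul, int_cos_pi, int_cos_pi, if_neg (by omega : ¬ ((n + m : ℤ) = 0))]
  · by_cases h : n = m
    · rw [if_pos (by omega), if_pos h]; ring
    · rw [if_neg (by omega), if_neg h]; ring
  · exact Continuous.intervalIntegrable (by fun_prop) _ _
  · exact Continuous.intervalIntegrable (by fun_prop) _ _

lemma Qk_sin {r : ℝ} (h0 : 0 ≤ r) (h1 : r < 1) (m : ℕ) (hm : 1 ≤ m) :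
    ∫ s in (-Real.pi)..Real.pi, Qk r s * Real.sin (m * s) = Real.pi * (m * r ^ m) := by
  have hsum : Summable (fun n : ℕ => (n : ℝ) * r ^ n) := by
    have := (hasSum_coe_mul_geometric_of_norm_lt_one (𝕜 := ℝ) (r := r)
      (by rwa [Real.norm_of_nonneg h0])).summable
    exact this
  have h := intervalIntegral.hasSum_integral_of_dominated_convergence (μ := volume)
    (a := -Real.pi) (b := Real.pi)
    (F := fun (n : ℕ) (s : ℝ) => (n : ℝ) * r ^ n * Real.sin (n * s) * Real.sin (m * s))
    (f := fun s => Qk r s * Real.sin (m * s))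
    (fun n _ => (n : ℝ) * r ^ n) (fun n => Continuous.aestronglyMeasurable (by fun_prop))
    (fun n => Eventually.of_forall fun s _ => by
      rw [norm_mul, norm_mul, Real.norm_of_nonneg (by positivity : 0 ≤ (n : ℝ) * r ^ n), mul_assoc]
      refine mul_le_of_le_one_right (by positivity) ?_
      exact mul_le_one₀ (Real.abs_sin_le_one _) (norm_nonneg _) (Real.abs_sin_le_one _))
    (Eventually.of_forall fun s _ => hsum) (by simp)
    (Eventually.of_forall fun s _ => (Qk_hasSum h0 h1 s).mul_right _)
  have e : ∀ n : ℕ, ∫ s in (-Real.pi)..Real.pi,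
      (n : ℝ) * r ^ n * Real.sin (n * s) * Real.sin (m * s)
      = if n = m then Real.pi * (m * r ^ m) else 0 := by
    intro n
    simp only [mul_assoc ((n : ℝ) * r ^ n)]
    rw [intervalIntegral.integral_const_mul, int_sin_sin n m hm]
    split_ifs with hh
    · subst hh; ring
    · ring
  simp only [e] at h
  refine h.unique ?_
  exact hasSum_ite_eq m _

lemma Qk_neg (r s : ℝ) : Qk r (-s) = -Qk r s := by
  simp only [Qk, Real.sin_neg, Real.cos_neg]; ring

lemma Qk_cos (r : ℝ) (c : ℝ) :
    ∫ s in (-Real.pi)..Real.pi, Qk r s * Real.cos (c * s) = 0 := by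
  have h := intervalIntegral.integral_comp_neg (a := -Real.pi) (b := Real.pi)
    (fun s => Qk r s * Real.cos (c * s))
  simp only [Qk_neg, mul_neg, Real.cos_neg, neg_mul, neg_neg, intervalIntegral.integral_neg] at h
  linarith


lemma prim_repr {I : ℚt} (hI : I ∈ USphere) {a : ℕ → ℚt} (ha : MemH2 a) {r : ℝ} (h0 : 0 ≤ r)
    (h1 : r < 1) (θ : ℝ) :
    ∫ s in (-Real.pi)..Real.pi, Qk r s • prim I a (θ + s) =
      Real.pi • (evalS a ((r : ℚt) * ptOn I θ) - a 0) := by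
  have hQ := Qk_cont h0 h1
  have hF : ∀ (n : ℕ) (s : ℝ), Qk r s • (ptOn I (((n + 1 : ℕ) : ℝ) * (θ + s)) * prc I a n) =
      (Qk r s * Real.cos (((n + 1 : ℕ) : ℝ) * s)) • (ptOn I (((n + 1 : ℕ) : ℝ) * θ) * prc I a n) +
      (Qk r s * Real.sin (((n + 1 : ℕ) : ℝ) * s)) •
        (I * ptOn I (((n + 1 : ℕ) : ℝ) * θ) * prc I a n) := by
    intro n s
    rw [mul_add, ptOn_add hI, ← ptOn_comm]
    conv_lhs => rw [ptOn.eq_1 I (((n + 1 : ℕ) : ℝ) * s)]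
    simp only [coe_eq_smul, mul_add, add_mul, smul_mul_assoc, mul_smul_comm, mul_one, smul_add,
      smul_smul]
  have hFc : ∀ n : ℕ, Continuous fun s : ℝ =>
      Qk r s • (ptOn I (((n + 1 : ℕ) : ℝ) * (θ + s)) * prc I a n) := by
    intro n
    simp only [hF]
    have h3 : Continuous fun s : ℝ => Qk r s * Real.cos (((n + 1 : ℕ) : ℝ) * s) :=
      hQ.mul (by fun_prop)
    have h4 : Continuous fun s : ℝ => Qk r s * Real.sin (((n + 1 : ℕ) : ℝ) * s) :=
      hQ.mul (by fun_prop)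
    exact (h3.smul continuous_const).add (h4.smul continuous_const)
  have hsp := summ_prc hI ha
  have hsn : ∀ t : ℝ, Summable fun n : ℕ => ptOn I (((n + 1 : ℕ) : ℝ) * t) * prc I a n := by
    intro t
    refine Summable.of_norm ?_
    simp only [norm_term hI]
    exact hsp
  have h := intervalIntegral.hasSum_integral_of_dominated_convergence (μ := volume)
    (a := -Real.pi) (b := Real.pi)
    (F := fun (n : ℕ) (s : ℝ) => Qk r s • (ptOn I (((n + 1 : ℕ) : ℝ) * (θ + s)) * prc I a n))
    (f := fun s => Qk r s • prim I a (θ + s))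
    (fun n s => |Qk r s| * ‖prc I a n‖) (fun n => (hFc n).aestronglyMeasurable)
    (fun n => Eventually.of_forall fun s _ => by
      rw [norm_smul, norm_term hI, Real.norm_eq_abs])
    (Eventually.of_forall fun s _ => hsp.mul_left _)
    (by
      simp only [tsum_mul_left]
      exact (hQ.abs.mul continuous_const).intervalIntegrable _ _)
    (Eventually.of_forall fun s _ => (hsn (θ + s)).hasSum.const_smul _)
  have e : ∀ n : ℕ, ∫ s in (-Real.pi)..Real.pi,
      Qk r s • (ptOn I (((n + 1 : ℕ) : ℝ) * (θ + s)) * prc I a n)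
      = Real.pi • (r ^ (n + 1) • (ptOn I (((n + 1 : ℕ) : ℝ) * θ) * a (n + 1))) := by
    intro n
    simp only [hF]
    have h3 : Continuous fun s : ℝ => Qk r s * Real.cos (((n + 1 : ℕ) : ℝ) * s) :=
      hQ.mul (by fun_prop)
    have h4 : Continuous fun s : ℝ => Qk r s * Real.sin (((n + 1 : ℕ) : ℝ) * s) :=
      hQ.mul (by fun_prop)
    have h5 : Continuous fun s : ℝ => (Qk r s * Real.cos (((n + 1 : ℕ) : ℝ) * s)) •
        (ptOn I (((n + 1 : ℕ) : ℝ) * θ) * prc I a n) := h3.smul continuous_const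
    have h6 : Continuous fun s : ℝ => (Qk r s * Real.sin (((n + 1 : ℕ) : ℝ) * s)) •
        (I * ptOn I (((n + 1 : ℕ) : ℝ) * θ) * prc I a n) := h4.smul continuous_const
    rw [intervalIntegral.integral_add (h5.intervalIntegrable _ _) (h6.intervalIntegrable _ _),
      intervalIntegral.integral_smul_const, intervalIntegral.integral_smul_const, Qk_cos,
      Qk_sin h0 h1 (n + 1) (by omega), zero_smul, zero_add, ← deriv_coef hI, smul_smul, smul_smul]
    congr 1
    ring
  simp only [e] at h
  rw [evalS_tail hI ha h0 h1, ← h.tsum_eq]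
  exact tsum_const_smul'' _

lemma Qk_le {r : ℝ} (h0 : 1 / 2 ≤ r) (h1 : r < 1) {c s : ℝ} (hc : c < 1) (hs : Real.cos s ≤ c) :
    |Qk r s| ≤ (1 - r ^ 2) / (1 - c) ^ 2 := by
  have hr : 0 ≤ 1 - r ^ 2 := by nlinarith
  have hd : 1 - c ≤ 1 - 2 * r * Real.cos s + r ^ 2 := by
    nlinarith [sq_nonneg (1 - r), mul_nonneg (by linarith : (0:ℝ) ≤ 2 * r - 1) (sub_nonneg.2 (Real.cos_le_one s))]
  have hp : 0 < 1 - c := by linarith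
  rw [Qk, abs_div, abs_of_nonneg (a := (1 - 2 * r * Real.cos s + r ^ 2) ^ 2) (sq_nonneg _)]
  have hn : |r * (1 - r ^ 2) * Real.sin s| ≤ 1 - r ^ 2 := by
    rw [abs_mul, abs_mul, abs_of_nonneg (by linarith : 0 ≤ r), abs_of_nonneg hr]
    have h2 := Real.abs_sin_le_one s
    have h3 : r * (1 - r ^ 2) ≤ 1 - r ^ 2 := by nlinarith
    calc r * (1 - r ^ 2) * |Real.sin s| ≤ r * (1 - r ^ 2) :=
          mul_le_of_le_one_right (mul_nonneg (by linarith) hr) h2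
      _ ≤ _ := h3
  exact div_le_div₀ hr hn (by positivity) (pow_le_pow_left₀ hp.le hd 2)

lemma Qk_sin_nonneg {r : ℝ} (h0 : 0 ≤ r) (h1 : r < 1) (s : ℝ) : |Qk r s| * |Real.sin s| = Qk r s * Real.sin s := by
  rw [← abs_mul, abs_of_nonneg]
  have hr : 0 ≤ 1 - r ^ 2 := by nlinarith
  have : Qk r s * Real.sin s = r * (1 - r ^ 2) * (Real.sin s) ^ 2 / (1 - 2 * r * Real.cos s + r ^ 2) ^ 2 := by
    rw [Qk]; ring
  rw [this]; positivity

/-- abstract Fatou step -/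
lemma fatou_step {g : ℝ → ℚt} (hg : Continuous g) {θ : ℝ} {L : ℚt} (hd : HasDerivAt g L θ) :
    Tendsto (fun r => Real.pi⁻¹ • ∫ s in (-Real.pi)..Real.pi, Qk r s • g (θ + s)) (𝓝[<] 1) (𝓝 L) := by
  have hpi := Real.pi_pos
  set E : ℝ → ℚt := fun s => g (θ + s) - g θ - Real.sin s • L with hE
  have hEc : Continuous E := by
    have h1 : Continuous fun s => g (θ + s) := hg.comp (by fun_prop)
    exact (h1.sub continuous_const).sub (Real.continuous_sin.smul continuous_const)
  have hrep : ∀ r ∈ Set.Ioo (0 : ℝ) 1, ∫ s in (-Real.pi)..Real.pi, Qk r s • E s =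
      (∫ s in (-Real.pi)..Real.pi, Qk r s • g (θ + s)) - (Real.pi * r) • L := by
    intro r hr
    have hQ := Qk_cont hr.1.le hr.2
    have e : ∀ s, Qk r s • E s = Qk r s • g (θ + s) - (Qk r s * Real.cos (0 * s)) • g θ
        - (Qk r s * Real.sin ((1 : ℕ) * s)) • L := by
      intro s
      simp [hE, smul_sub, smul_smul]
    have c1 : Continuous fun s => Qk r s • g (θ + s) := hQ.smul (hg.comp (by fun_prop))
    have c2 : Continuous fun s => (Qk r s * Real.cos (0 * s)) • g θ :=
      (hQ.mul (by fun_prop)).smul continuous_const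
    have c3 : Continuous fun s => (Qk r s * Real.sin ((1 : ℕ) * s)) • L :=
      (hQ.mul (by fun_prop)).smul continuous_const
    have c4 : Continuous fun s => Qk r s • g (θ + s) - (Qk r s * Real.cos (0 * s)) • g θ := c1.sub c2
    simp only [e]
    rw [intervalIntegral.integral_sub (c4.intervalIntegrable _ _) (c3.intervalIntegrable _ _),
      intervalIntegral.integral_sub (c1.intervalIntegrable _ _) (c2.intervalIntegrable _ _),
      intervalIntegral.integral_smul_const, intervalIntegral.integral_smul_const, Qk_cos,
      Qk_sin hr.1.le hr.2 1 le_rfl]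
    simp
  have hIoo : Set.Ioo (1 / 2 : ℝ) 1 ∈ 𝓝[<] (1 : ℝ) := Ioo_mem_nhdsLT (by norm_num)
  have key : Tendsto (fun r => ∫ s in (-Real.pi)..Real.pi, Qk r s • E s) (𝓝[<] 1) (𝓝 0) := by
    rw [Metric.tendsto_nhds]
    intro ε hε
    -- local estimate
    set η : ℝ := ε / (4 * Real.pi) with hη
    have hη0 : 0 < η := by positivity
    have hsin : HasDerivAt (fun s : ℝ => Real.sin s • L) L 0 := by
      have := (Real.hasDerivAt_sin 0).smul_const L
      simpa using this
    have hgd : HasDerivAt (fun s : ℝ => g (θ + s)) L 0 := by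
      have := HasDerivAt.comp_const_add (f := g) (f' := L) θ 0 (by simpa using hd)
      exact this
    have hEd : HasDerivAt E 0 0 := by
      have := (hgd.sub_const (g θ)).sub hsin
      rw [sub_self] at this
      exact this
    have hE0 : E 0 = 0 := by simp [hE]
    have hlo := hEd.isLittleO
    have hev := hlo.def (c := η * (2 / Real.pi)) (by positivity)
    obtain ⟨δ, hδ, hloc⟩ := Metric.eventually_nhds_iff.1 hev
    set d : ℝ := min (δ / 2) (Real.pi / 2) with hdd
    have hd0 : 0 < d := by positivity
    have hloc2 : ∀ s, |s| ≤ d → ‖E s‖ ≤ η * |Real.sin s| := by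
      intro s hs
      have h1 : dist s 0 < δ := by
        rw [Real.dist_eq, sub_zero]
        have := min_le_left (δ / 2) (Real.pi / 2)
        linarith
      have h2 := hloc h1
      simp only [hE0, sub_zero, smul_zero, Real.norm_eq_abs] at h2
      have h3 := Real.mul_abs_le_abs_sin (hs.trans (min_le_right _ _))
      calc ‖E s‖ ≤ η * (2 / Real.pi) * |s| := h2
        _ = η * (2 / Real.pi * |s|) := by ring
        _ ≤ _ := mul_le_mul_of_nonneg_left h3 hη0.le
    obtain ⟨M, hM⟩ := (isCompact_Icc (a := -Real.pi) (b := Real.pi)).exists_bound_of_continuousOn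
      hEc.continuousOn
    have hM0 : 0 ≤ M := (norm_nonneg _).trans (hM 0 ⟨by linarith, by linarith⟩)
    set c := Real.cos d with hc
    have hdpi : d ≤ Real.pi / 2 := min_le_right _ _
    have hc1 : c < 1 := by
      have := Real.cos_lt_cos_of_nonneg_of_le_pi_div_two le_rfl hdpi hd0
      simpa using this
    have hfar : ∀ s, s ∈ Set.Icc (-Real.pi) Real.pi → d ≤ |s| → Real.cos s ≤ c := by
      intro s hs hds
      rw [← Real.cos_abs s]
      exact Real.cos_le_cos_of_nonneg_of_le_pi hd0.le (abs_le.2 hs) hds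
    have hsmall : ∀ᶠ r in 𝓝[<] (1 : ℝ), 2 * Real.pi * (M * ((1 - r ^ 2) / (1 - c) ^ 2)) < ε / 2 := by
      have : Continuous fun r : ℝ => 2 * Real.pi * (M * ((1 - r ^ 2) / (1 - c) ^ 2)) := by fun_prop
      have h2 := (this.tendsto 1).mono_left (nhdsWithin_le_nhds (s := Set.Iio 1))
      refine h2.eventually (gt_mem_nhds ?_)
      simp [hε]
    filter_upwards [hIoo, hsmall] with r hr hs
    rw [dist_zero_right]
    have hr0 : 0 ≤ r := by linarith [hr.1]
    have hQ := Qk_cont hr0 hr.2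
    have hr2 : 0 ≤ 1 - r ^ 2 := by nlinarith [hr.2]
    set B := M * ((1 - r ^ 2) / (1 - c) ^ 2) with hB
    have hB0 : 0 ≤ B := by positivity
    have hpt : ∀ s ∈ Set.Ioc (-Real.pi) Real.pi,
        ‖Qk r s • E s‖ ≤ η * (Qk r s * Real.sin ((1 : ℕ) * s)) + B := by
      intro s hs
      have hs' := Set.Ioc_subset_Icc_self hs
      have hq := Qk_sin_nonneg hr0 hr.2 s
      have hq0 : 0 ≤ Qk r s * Real.sin s := hq ▸ mul_nonneg (abs_nonneg _) (abs_nonneg _)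
      rw [norm_smul, Real.norm_eq_abs]
      simp only [Nat.cast_one, one_mul]
      rcases le_total |s| d with hsd | hsd
      · have := mul_le_mul_of_nonneg_left (hloc2 s hsd) (abs_nonneg (Qk r s))
        rw [← hq]
        nlinarith
      · have h5 := mul_le_mul (Qk_le hr.1.le hr.2 hc1 (hfar s hs' hsd)) (hM s hs') (norm_nonneg _)
          (by positivity)
        have := mul_nonneg hη0.le hq0
        rw [hB, mul_comm M]
        linarith
    have c3 : Continuous fun s => Qk r s * Real.sin ((1 : ℕ) * s) := hQ.mul (by fun_prop)
    have c4 : Continuous fun s => η * (Qk r s * Real.sin ((1 : ℕ) * s)) := continuous_const.mul c3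
    have hint := intervalIntegral.norm_integral_le_of_norm_le (μ := volume)
      (by linarith : -Real.pi ≤ Real.pi)
      (Eventually.of_forall hpt)
      ((c4.add continuous_const).intervalIntegrable _ _)
    rw [intervalIntegral.integral_add (c4.intervalIntegrable _ _)
      (continuous_const.intervalIntegrable _ _), intervalIntegral.integral_const_mul,
      Qk_sin hr0 hr.2 1 le_rfl, intervalIntegral.integral_const] at hint
    have h6 : η * (Real.pi * (((1 : ℕ) : ℝ) * r ^ 1)) ≤ ε / 4 := by
      have : η * Real.pi = ε / 4 := by rw [hη]; field_simp
      simp only [Nat.cast_one, one_mul, pow_one]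
      rw [← mul_assoc, this]
      nlinarith [hr.2]
    have h7 : (Real.pi - -Real.pi) • B = 2 * Real.pi * B := by rw [smul_eq_mul]; ring
    rw [h7] at hint
    refine hint.trans_lt ((add_lt_add_of_le_of_lt h6 hs).trans ?_)
    linarith
  have h8 : Tendsto (fun r : ℝ => Real.pi⁻¹ • (∫ s in (-Real.pi)..Real.pi, Qk r s • E s) + r • L)
      (𝓝[<] 1) (𝓝 (Real.pi⁻¹ • (0 : ℚt) + (1 : ℝ) • L)) := by
    refine (key.const_smul _).add ?_
    have : Continuous fun r : ℝ => r • L := continuous_id.smul continuous_const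
    exact (this.tendsto 1).mono_left nhdsWithin_le_nhds
  simp only [smul_zero, zero_add, one_smul] at h8
  refine h8.congr' ?_
  filter_upwards [hIoo] with r hr
  rw [hrep r ⟨by linarith [hr.1], hr.2⟩, smul_sub, smul_smul, ← mul_assoc, inv_mul_cancel₀ hpi.ne', one_mul,
    sub_add_cancel]

theorem fatou_q {I : ℚt} (hI : I ∈ USphere) {a : ℕ → ℚt} (ha : MemH2 a) {C : ℝ}
    (hC : ∀ q ∈ QBall, ‖evalS a q‖ ≤ C) :
    ∀ᵐ t : ℝ, ∃ L, Tendsto (fun r : ℝ => evalS a ((r : ℚt) * ptOn I t)) (𝓝[<] 1) (𝓝 L) := by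
  obtain ⟨K, hK⟩ := prim_lip hI ha hC
  filter_upwards [hK.ae_differentiableAt_real] with t ht
  refine ⟨deriv (prim I a) t + a 0, ?_⟩
  have h := (fatou_step hK.continuous ht.hasDerivAt).add_const (a 0)
  refine h.congr' ?_
  have hIoo : Set.Ioo (0 : ℝ) 1 ∈ 𝓝[<] (1 : ℝ) := Ioo_mem_nhdsLT (by norm_num)
  filter_upwards [hIoo] with r hr
  rw [prim_repr hI ha hr.1.le hr.2, smul_smul, inv_mul_cancel₀ Real.pi_pos.ne', one_smul,
    sub_add_cancel]


lemma bdval_eq {a : ℕ → ℚt} {q L : ℚt}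
    (h : Tendsto (fun r : ℝ => evalS a ((r : ℚt) * q)) (𝓝[<] (1 : ℝ)) (𝓝 L)) : bdval a q = L := by
  have hex : ∃ L, Tendsto (fun r : ℝ => evalS a ((r : ℚt) * q)) (𝓝[<] (1 : ℝ)) (𝓝 L) := ⟨L, h⟩
  rw [bdval, dif_pos hex]
  exact tendsto_nhds_unique hex.choose_spec h

lemma bdval_tendsto {a : ℕ → ℚt} {q : ℚt}
    (h : ∃ L, Tendsto (fun r : ℝ => evalS a ((r : ℚt) * q)) (𝓝[<] (1 : ℝ)) (𝓝 L)) :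
    Tendsto (fun r : ℝ => evalS a ((r : ℚt) * q)) (𝓝[<] (1 : ℝ)) (𝓝 (bdval a q)) := by
  obtain ⟨L, hL⟩ := h
  rwa [bdval_eq hL]

lemma bdval_tendsto_of_norm {a : ℕ → ℚt} {q : ℚt} (h : ‖bdval a q‖ = 1) :
    ∃ L, Tendsto (fun r : ℝ => evalS a ((r : ℚt) * q)) (𝓝[<] (1 : ℝ)) (𝓝 L) := by
  by_contra hc
  rw [bdval, dif_neg hc] at h
  simp at h

lemma Ioo_mem01 : Set.Ioo (0 : ℝ) 1 ∈ 𝓝[<] (1 : ℝ) := Ioo_mem_nhdsLT (by norm_num)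

lemma slice_int {I : ℚt} (hI : I ∈ USphere) {a : ℕ → ℚt} (ha : MemH2 a)
    (h1 : ∀ q ∈ QBall, ‖evalS a q‖ ≤ 1)
    (hae : ∀ᵐ t : ℝ ∂(volume.restrict (Set.Ico 0 (2 * Real.pi))),
      ∃ L, Tendsto (fun r : ℝ => evalS a ((r : ℚt) * ptOn I t)) (𝓝[<] 1) (𝓝 L)) :
    ∫ t in Set.Ico 0 (2 * Real.pi), ‖bdval a (ptOn I t)‖ ^ 2 = 2 * Real.pi * h2normSq a := by
  have hp := Real.pi_pos
  have hL : Tendsto (fun r : ℝ => ∫ t in Set.Ico 0 (2 * Real.pi), ‖evalS a ((r : ℚt) * ptOn I t)‖ ^ 2)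
      (𝓝[<] 1) (𝓝 (∫ t in Set.Ico 0 (2 * Real.pi), ‖bdval a (ptOn I t)‖ ^ 2)) := by
    refine tendsto_integral_filter_of_dominated_convergence (fun _ => 1) ?_ ?_ ?_ ?_
    · filter_upwards [Ioo_mem01] with r hr
      exact ((cont_slice hI ha hr.1.le hr.2).norm.pow 2).aestronglyMeasurable
    · filter_upwards [Ioo_mem01] with r hr
      refine Eventually.of_forall fun t => ?_
      rw [Real.norm_of_nonneg (by positivity)]
      exact pow_le_one₀ (norm_nonneg _) (h1 _ (mem_ball_slice hI hr.1.le hr.2 t))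
    · exact integrable_const _
    · filter_upwards [hae] with t ht
      exact (bdval_tendsto ht).norm.pow 2
  refine tendsto_nhds_unique hL (((abel_sq ha).const_mul (2 * Real.pi)).congr' ?_)
  filter_upwards [Ioo_mem01] with r hr
  rw [← parseval_eval hI ha hr.1.le hr.2, intervalIntegral.integral_of_le (by positivity),
    integral_Ico_eq_integral_Ioo, integral_Ioc_eq_integral_Ioo]

lemma hInf_eq_one {a : ℕ → ℚt} (ha : MemH2 a) (h : ∀ q ∈ QBall, ‖evalS a q‖ ≤ 1)
    (h2 : h2normSq a = 1) : hInfNorm a = 1 := by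
  have hne : ((fun q => ‖evalS a q‖) '' QBall).Nonempty := ⟨_, 0, by simp [QBall], rfl⟩
  have hb : ∀ x ∈ (fun q => ‖evalS a q‖) '' QBall, x ≤ 1 := by
    rintro _ ⟨q, hq, rfl⟩
    exact h q hq
  have hle : hInfNorm a ≤ 1 := csSup_le hne hb
  have h0 : 0 ≤ hInfNorm a := Real.sSup_nonneg (by rintro _ ⟨q, hq, rfl⟩; exact norm_nonneg _)
  have := h2_le_sup ha h0 (fun q hq => le_csSup ⟨1, hb⟩ ⟨q, hq, rfl⟩)
  rw [h2] at this
  nlinarith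

lemma bound_of_hInf {a : ℕ → ℚt} (h : hInfNorm a = 1) : ∀ q ∈ QBall, ‖evalS a q‖ ≤ 1 := by
  intro q hq
  have hb : BddAbove ((fun q => ‖evalS a q‖) '' QBall) := by
    by_contra hc
    rw [hInfNorm, Real.sSup_of_not_bddAbove hc] at h
    norm_num at h
  rw [← h]
  exact le_csSup hb ⟨q, hq, rfl⟩

lemma h2norm_iff (a : ℕ → ℚt) : h2norm a = 1 ↔ h2normSq a = 1 := by
  rw [h2norm, Real.sqrt_eq_one]

lemma one_two {a : ℕ → ℚt} (h : IsInnerQ a) : h2norm a = 1 ∧ hInfNorm a = 1 := by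
  obtain ⟨ha, hb, hae⟩ := h
  have hp := Real.pi_pos
  suffices h2 : h2normSq a = 1 from ⟨(h2norm_iff a).2 h2, hInf_eq_one ha hb h2⟩
  rw [SigmaBd] at hae
  have hae2 := (Measure.ae_ennreal_smul_measure_iff (ENNReal.inv_ne_zero.2 ENNReal.ofReal_ne_top)).1 hae
  have hae3 := ae_of_ae_map ptOn_continuous.measurable.aemeasurable hae2
  have hae4 : ∀ᵐ p ∂(sphMeasure.prod (volume.restrict (Set.Ico 0 (2 * Real.pi)))),
      ‖bdval a (ptOn p.1 p.2)‖ = 1 := by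
    rw [← Measure.prod_swap] at hae3
    exact ae_of_ae_map measurable_swap.aemeasurable hae3
  have hae5 := Measure.ae_ae_of_ae_prod hae4
  obtain ⟨I, hI1, hI⟩ := (hae5.and sph_ae_mem).exists
  have := slice_int hI ha hb (hI1.mono fun t ht => bdval_tendsto_of_norm ht)
  rw [integral_congr_ae (g := fun _ => (1 : ℝ)) (hI1.mono fun t ht => by simp only at ht; simp [ht])] at this
  simp at this
  rw [max_eq_left (by positivity)] at this
  have h3 : 2 * Real.pi * (h2normSq a - 1) = 0 := by linarith
  rcases mul_eq_zero.1 h3 with h4 | h4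
  · linarith
  · linarith

lemma slice_ae {I : ℚt} (hI : I ∈ USphere) {a : ℕ → ℚt} (ha : MemH2 a)
    (h1 : ∀ q ∈ QBall, ‖evalS a q‖ ≤ 1) (h2 : h2normSq a = 1) :
    ∀ᵐ t : ℝ ∂(volume.restrict (Set.Ico 0 (2 * Real.pi))),
      (∃ L, Tendsto (fun r : ℝ => evalS a ((r : ℚt) * ptOn I t)) (𝓝[<] 1) (𝓝 L)) ∧
        ‖bdval a (ptOn I t)‖ = 1 := by
  have hp := Real.pi_pos
  have hf := ae_restrict_of_ae (s := Set.Ico 0 (2 * Real.pi)) (fatou_q hI ha h1)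
  have hint := slice_int hI ha h1 hf
  rw [h2, mul_one] at hint
  have hi : Integrable (fun t => ‖bdval a (ptOn I t)‖ ^ 2)
      (volume.restrict (Set.Ico 0 (2 * Real.pi))) := by
    by_contra hc
    rw [integral_undef hc] at hint
    linarith
  have hle : ∀ᵐ t : ℝ ∂(volume.restrict (Set.Ico 0 (2 * Real.pi))), ‖bdval a (ptOn I t)‖ ≤ 1 := by
    filter_upwards [hf] with t ht
    refine le_of_tendsto (bdval_tendsto ht).norm ?_
    filter_upwards [Ioo_mem01] with r hr
    exact h1 _ (mem_ball_slice hI hr.1.le hr.2 t)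
  have hz : ∫ t in Set.Ico 0 (2 * Real.pi), (1 - ‖bdval a (ptOn I t)‖ ^ 2) = 0 := by
    rw [integral_sub (integrable_const _) hi, hint]
    simp
    rw [max_eq_left (by positivity)]
    ring
  have h0 : 0 ≤ᵐ[volume.restrict (Set.Ico 0 (2 * Real.pi))]
      fun t => 1 - ‖bdval a (ptOn I t)‖ ^ 2 := by
    filter_upwards [hle] with t ht
    have := norm_nonneg (bdval a (ptOn I t))
    simp only [Pi.zero_apply]
    nlinarith
  have he := (integral_eq_zero_iff_of_nonneg_ae h0 ((integrable_const _).sub hi)).1 hz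
  filter_upwards [hf, he] with t ht het
  refine ⟨ht, ?_⟩
  simp only [Pi.zero_apply] at het
  have : ‖bdval a (ptOn I t)‖ ^ 2 = 1 := by linarith
  nlinarith [norm_nonneg (bdval a (ptOn I t))]

/-- the rational filter -/
noncomputable def ratF : Filter ℚ := comap (fun x : ℚ => (x : ℝ)) (𝓝[<] (1 : ℝ))

lemma rat_tendsto {φ : ℝ → ℚt} (hφ : ContinuousOn φ (Set.Ioo 0 1)) (L : ℚt) :
    Tendsto φ (𝓝[<] 1) (𝓝 L) ↔ Tendsto (fun x : ℚ => φ x) ratF (𝓝 L) := by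
  constructor
  · intro h
    exact h.comp tendsto_comap
  · intro h
    rw [Metric.tendsto_nhds] at h ⊢
    intro ε hε
    have h2 := h (ε / 2) (by positivity)
    rw [ratF, eventually_comap] at h2
    obtain ⟨c, hc, hc2⟩ := (mem_nhdsLT_iff_exists_Ioo_subset' (show (0 : ℝ) < 1 by norm_num)).1
      (inter_mem h2 Ioo_mem01)
    have hc1 : Set.Ioo c 1 ∈ 𝓝[<] (1 : ℝ) := Ioo_mem_nhdsLT hc
    filter_upwards [hc1] with r hr
    have hr01 := (hc2 hr).2
    refine lt_of_le_of_lt ?_ (half_lt_self hε)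
    have hcont : ContinuousAt φ r := hφ.continuousAt (Ioo_mem_nhds hr01.1 hr01.2)
    by_contra hcon
    push Not at hcon
    have hev : ∀ᶠ x in 𝓝 r, ε / 2 < dist (φ x) L :=
      (hcont.dist continuousAt_const).eventually (lt_mem_nhds hcon)
    have hev2 := hev.and (Ioo_mem_nhds hr.1 hr.2)
    obtain ⟨x, hx1⟩ := Rat.isDenseEmbedding_coe_real.dense.exists_mem_open isOpen_interior
      ⟨r, mem_interior_iff_mem_nhds.2 hev2⟩
    obtain ⟨h3, h4⟩ := interior_subset hx1
    exact absurd ((hc2 h4).1 x rfl) (not_lt.2 h3.le)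

lemma slice_contOn {a : ℕ → ℚt} (ha : MemH2 a) {q : ℚt} (hq : ‖q‖ = 1) :
    ContinuousOn (fun r : ℝ => evalS a ((r : ℚt) * q)) (Set.Ioo 0 1) := by
  intro r hr
  have hb : ‖(r : ℚt) * q‖ < 1 := by
    rw [norm_mul, hq, mul_one, Quaternion.norm_coe, Real.norm_of_nonneg hr.1.le]
    exact hr.2
  have h2 : ContinuousAt (fun r : ℝ => (r : ℚt) * q) r :=
    (Quaternion.continuous_coe.mul continuous_const).continuousAt
  exact (ContinuousAt.comp (g := evalS a) (f := fun r : ℝ => (r : ℚt) * q) (evalS_cont_at ha hb) h2).continuousWithinAt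

/-- the measurable truncations -/
noncomputable def trH (a : ℕ → ℚt) (x : ℚ) : ℚt → ℚt :=
  if (0 : ℝ) < x ∧ (x : ℝ) < 1 then
    Set.piecewise {q : ℚt | ‖q‖ = 1} (fun q => evalS a (((x : ℝ) : ℚt) * q)) (fun _ => 0)
  else fun _ => 0

lemma trH_meas {a : ℕ → ℚt} (ha : MemH2 a) (x : ℚ) : Measurable (trH a x) := by
  unfold trH
  split_ifs with h
  · refine ContinuousOn.measurable_piecewise ?_ continuousOn_const
      (isClosed_eq continuous_norm continuous_const).measurableSet
    intro q hq
    have hq : ‖q‖ = 1 := hq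
    have hb : ‖((x : ℝ) : ℚt) * q‖ < 1 := by
      rw [norm_mul, hq, mul_one, Quaternion.norm_coe, Real.norm_of_nonneg h.1.le]
      exact h.2
    have h2 : ContinuousAt (fun q : ℚt => ((x : ℝ) : ℚt) * q) q :=
      (continuous_const.mul continuous_id).continuousAt
    exact (ContinuousAt.comp (g := evalS a) (f := fun q : ℚt => ((x : ℝ) : ℚt) * q) (evalS_cont_at ha hb) h2).continuousWithinAt
  · exact measurable_const

instance ratF_gen : ratF.IsCountablyGenerated := by unfold ratF; infer_instance

/-- the good set -/
noncomputable def goodS (a : ℕ → ℚt) : Set ℚt :=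
  {q | ‖q‖ = 1} ∩ ({q | ∃ L, Tendsto (fun x : ℚ => trH a x q) ratF (𝓝 L)} ∩
    {q | Tendsto (fun x : ℚ => ‖trH a x q‖) ratF (𝓝 1)})

lemma goodS_meas {a : ℕ → ℚt} (ha : MemH2 a) : MeasurableSet (goodS a) := by
  refine (isClosed_eq continuous_norm continuous_const).measurableSet.inter (MeasurableSet.inter ?_ ?_)
  · exact MeasureTheory.measurableSet_exists_tendsto (trH_meas ha)
  · exact measurableSet_tendsto _ fun x => (trH_meas ha x).norm

instance ratF_neBot : ratF.NeBot := by
  unfold ratF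
  rw [comap_neBot_iff]
  intro t ht
  obtain ⟨c, hc, hc2⟩ := (mem_nhdsLT_iff_exists_Ioo_subset' (show (0 : ℝ) < 1 by norm_num)).1 ht
  obtain ⟨x, hx1, hx2⟩ := exists_rat_btwn (show c < 1 from hc)
  exact ⟨x, hc2 ⟨hx1, hx2⟩⟩

lemma trH_ev (a : ℕ → ℚt) {q : ℚt} (hq : ‖q‖ = 1) :
    (fun x : ℚ => trH a x q) =ᶠ[ratF] fun x : ℚ => evalS a (((x : ℝ) : ℚt) * q) := by
  have : ∀ᶠ x : ℚ in ratF, (x : ℝ) ∈ Set.Ioo (0 : ℝ) 1 := tendsto_comap.eventually Ioo_mem01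
  filter_upwards [this] with x hx
  have hx' : (0 : ℝ) < x ∧ (x : ℝ) < 1 := hx
  rw [trH, if_pos hx']
  exact Set.piecewise_eq_of_mem _ _ _ hq

lemma mem_goodS {a : ℕ → ℚt} (ha : MemH2 a) {q : ℚt} (hq : ‖q‖ = 1) :
    q ∈ goodS a ↔ ‖bdval a q‖ = 1 := by
  have hl : ∀ L, Tendsto (fun x : ℚ => trH a x q) ratF (𝓝 L) ↔
      Tendsto (fun r : ℝ => evalS a ((r : ℚt) * q)) (𝓝[<] (1 : ℝ)) (𝓝 L) := by
    intro L
    rw [rat_tendsto (slice_contOn ha hq) L]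
    exact tendsto_congr' (trH_ev a hq)
  constructor
  · rintro ⟨_, ⟨L, hL⟩, h2⟩
    rw [bdval_eq ((hl L).1 hL)]
    exact tendsto_nhds_unique hL.norm h2
  · intro h
    have h3 := (hl _).2 (bdval_tendsto (bdval_tendsto_of_norm h))
    refine ⟨hq, ⟨_, h3⟩, ?_⟩
    have h4 := h3.norm
    rw [h] at h4
    exact h4

lemma two_one {a : ℕ → ℚt} (ha : MemH2 a) (h1 : ∀ q ∈ QBall, ‖evalS a q‖ ≤ 1)
    (h2 : h2normSq a = 1) : IsInnerQ a := by
  refine ⟨ha, h1, ?_⟩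
  have hG := goodS_meas ha
  have hmap : ∀ᵐ q ∂(Measure.map (fun p : ℝ × Quaternion ℝ => ptOn p.2 p.1)
      ((volume.restrict (Set.Ico 0 (2 * Real.pi))).prod sphMeasure)), q ∈ goodS a := by
    have hpre : MeasurableSet {p : ℝ × Quaternion ℝ | ptOn p.2 p.1 ∈ goodS a} :=
      ptOn_continuous.measurable hG
    rw [ae_map_iff (p := fun q => q ∈ goodS a) ptOn_continuous.measurable.aemeasurable hG,
      Measure.ae_prod_iff_ae_ae hpre,
      Measure.ae_ae_comm (p := fun (t : ℝ) (I : ℚt) => ptOn I t ∈ goodS a) hpre]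
    filter_upwards [sph_ae_mem] with I hI
    filter_upwards [slice_ae hI ha h1 h2] with t ht
    exact (mem_goodS ha (ptOn_norm hI t)).2 ht.2
  rw [SigmaBd]
  refine (Measure.ae_ennreal_smul_measure_iff (ENNReal.inv_ne_zero.2 ENNReal.ofReal_ne_top)).2 ?_
  filter_upwards [hmap] with q hq
  exact (mem_goodS ha hq.1).1 hq

/-- For `f ∈ H²(𝔹)` the following are equivalent: (i) `f` is inner;
(ii) `‖f‖_{H²} = ‖f‖_{H^∞} = 1`; (iii) `‖f‖_{H²} = 1` and for every `k ∈ ℕ` and `λ ∈ ℍ`,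
`‖(qᵏ + λ) * f‖_{H²} ≤ ‖qᵏ + λ‖_{H²}`. -/
theorem inner_iff_norm_conditions (a : ℕ → Quaternion ℝ) (ha : MemH2 a) :
    [ IsInnerQ a,
      h2norm a = 1 ∧ hInfNorm a = 1,
      h2norm a = 1 ∧ ∀ (k : ℕ) (l : Quaternion ℝ),
        h2norm (sProd (fun n => qpow k n + constS l n) a) ≤
          h2norm (fun n => qpow k n + constS l n) ].TFAE := by
  tfae_have 1 → 2 := one_two
  tfae_have 2 → 1 := fun h => two_one ha (bound_of_hInf h.2) ((h2norm_iff a).1 h.1)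
  tfae_have 2 → 3 := fun h => ⟨h.1, two_three ha (bound_of_hInf h.2)⟩
  tfae_have 3 → 2 := fun h =>
    ⟨h.1, hInf_eq_one ha (three_bound ha ((h2norm_iff a).1 h.1) h.2) ((h2norm_iff a).1 h.1)⟩
  tfae_finish
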